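/- arXiv:1711.02467 — 2 statements merged into one kernel-verified Lean document; each statement's English description precedes it below -/
import Mathlib

section
/- Let n ≥ 1, 0 < t_1 < … < t_n with F(t_1) > 0, and let g : (0,∞) → ℝ be a Borel function with E[|g(τ)|] < ∞. Then ℙ-a.s., E[g(τ) | σ(ξ_{t_1}, …, ξ_{t_n})] = (1/F(t_1)) ∫_{(0,t_1]} g(r) ℙ_τ(dr) · 1_{{ξ_{t_1} = 0}} + ∑_{k=1}^{n−1} ∫_{(t_k,t_{k+1}]} g(r) ψ_k(r, ξ_{t_k}) ℙ_τ(dr) · 1_{{ξ_{t_k} ≠ 0, ξ_{t_{k+1}} = 0}} + ∫_{(t_n,∞)} g(r) ϕ_{ξ^r_{t_n}}(ξ_{t_n}) ℙ_τ(dr) · 1_{{ξ_{t_n} ≠ 0}}. -/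
open MeasureTheory ProbabilityTheory Real Set

/-- Bayes' formula: if `(T, W)` has density `φ` with respect to `μ.prod ν`, then the posterior mean
of `g` given `W` has the same integral as `g ∘ T` over every event determined by `W`. -/
theorem integrable_posteriorMean_and_setIntegral_eq {Ω α β : Type*} [MeasurableSpace Ω]
    [MeasurableSpace α] [MeasurableSpace β] {Q : Measure Ω} [IsFiniteMeasure Q]
    {μ : Measure α} [SFinite μ] {ν : Measure β} [SFinite ν] {T : Ω → α} {W : Ω → β}
    (hT : Measurable T) (hW : Measurable W) {φ : α → β → ℝ}
    (hφ : Measurable (Function.uncurry φ)) (hφ0 : ∀ r w, 0 ≤ φ r w)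
    (hlaw : Q.map (fun ω => (T ω, W ω)) =
      (μ.prod ν).withDensity (fun x => ENNReal.ofReal (φ x.1 x.2)))
    {g : α → ℝ} (hg : Measurable g) (hgT : Integrable (fun ω => g (T ω)) Q) :
    Integrable (fun ω => (∫ r, g r * φ r (W ω) ∂μ) / ∫ r, φ r (W ω) ∂μ) Q ∧
    ∀ E, MeasurableSet E →
      ∫ ω in W ⁻¹' E, (∫ r, g r * φ r (W ω) ∂μ) / (∫ r, φ r (W ω) ∂μ) ∂Q =
        ∫ ω in W ⁻¹' E, g (T ω) ∂Q := by
  set h : β → ℝ := fun w => (∫ r, g r * φ r w ∂μ) / ∫ r, φ r w ∂μ with hh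
  have hφ1 : Measurable fun x : α × β => φ x.1 x.2 := hφ
  have hhm : Measurable h := by
    refine Measurable.div ?_ ?_
    · exact (StronglyMeasurable.integral_prod_left' (μ := μ)
        (f := fun x : α × β => g x.1 * φ x.1 x.2)
        ((hg.comp measurable_fst).mul hφ1).stronglyMeasurable).measurable
    · exact (StronglyMeasurable.integral_prod_left' (μ := μ) (f := fun x : α × β => φ x.1 x.2)
        hφ1.stronglyMeasurable).measurable
  have hTW : Measurable fun ω => (T ω, W ω) := hT.prodMk hW
  have hint : ∀ f : α × β → ℝ, Measurable f →
      (Integrable (fun ω => f (T ω, W ω)) Q ↔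
        Integrable (fun x => φ x.1 x.2 * f x) (μ.prod ν)) := by
    intro f hf
    have h1 := integrable_map_measure (μ := Q) (f := fun ω => (T ω, W ω)) (g := f)
      hf.aestronglyMeasurable hTW.aemeasurable
    rw [hlaw, integrable_withDensity_iff_integrable_smul' (by fun_prop) (by simp)] at h1
    simp only [ENNReal.toReal_ofReal (hφ0 _ _), smul_eq_mul] at h1
    exact h1.symm
  have hval : ∀ f : α × β → ℝ, Measurable f →
      ∫ ω, f (T ω, W ω) ∂Q = ∫ x, φ x.1 x.2 * f x ∂(μ.prod ν) := by
    intro f hf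
    have h1 := integral_map (μ := Q) (φ := fun ω => (T ω, W ω)) (f := f)
      hTW.aemeasurable hf.aestronglyMeasurable
    rw [hlaw, integral_withDensity_eq_integral_toReal_smul (by fun_prop) (by simp)] at h1
    simp only [ENNReal.toReal_ofReal (hφ0 _ _), smul_eq_mul] at h1
    exact h1.symm
  have iφ : Integrable (fun x : α × β => φ x.1 x.2) (μ.prod ν) := by
    simpa using (hint (fun _ => 1) measurable_const).1 (integrable_const _)
  have igφ : Integrable (fun x : α × β => φ x.1 x.2 * g x.1) (μ.prod ν) :=
    (hint (fun x => g x.1) (by fun_prop)).1 hgT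
  have key : ∀ᵐ w ∂ν, h w * ∫ r, φ r w ∂μ = ∫ r, φ r w * g r ∂μ := by
    filter_upwards [iφ.prod_left_ae] with w hw
    by_cases h0 : ∫ r, φ r w ∂μ = 0
    · have h1 := (integral_eq_zero_iff_of_nonneg (fun r => hφ0 r w) hw).1 h0
      rw [h0, mul_zero]
      symm
      apply integral_eq_zero_of_ae
      filter_upwards [h1] with r hr
      simp only [Pi.zero_apply] at hr
      simp [hr]
    · simp only [hh, div_mul_cancel₀ _ h0, mul_comm]
  have ihφ : Integrable (fun x : α × β => φ x.1 x.2 * h x.2) (μ.prod ν) := by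
    rw [integrable_prod_iff' (by fun_prop)]
    refine ⟨?_, ?_⟩
    · filter_upwards [iφ.prod_left_ae] with w hw using hw.mul_const _
    · refine igφ.integral_prod_right.norm.congr ?_
      filter_upwards [key] with w hw
      rw [← hw]
      simp only [norm_mul, Real.norm_eq_abs, abs_of_nonneg (hφ0 _ _)]
      rw [integral_mul_const, abs_of_nonneg (integral_nonneg fun r => hφ0 r w), mul_comm]
  refine ⟨(hint (fun x => h x.2) (by fun_prop)).2 ihφ, fun E hE => ?_⟩
  have hind : Measurable (E.indicator (fun _ => (1 : ℝ))) := measurable_const.indicator hE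
  have conv : ∀ f : Ω → ℝ, ∫ ω in W ⁻¹' E, f ω ∂Q =
      ∫ ω, f ω * E.indicator (fun _ => (1 : ℝ)) (W ω) ∂Q := by
    intro f
    rw [← integral_indicator (hW hE)]
    congr 1 with ω
    by_cases hω : W ω ∈ E <;> simp [hω]
  have bdd : ∀ f : α × β → ℝ, Integrable f (μ.prod ν) → Integrable
      (fun x => f x * E.indicator (fun _ => (1 : ℝ)) x.2) (μ.prod ν) := by
    intro f hf
    refine hf.mul_bdd (c := 1) (hind.comp measurable_snd).aestronglyMeasurable
      (.of_forall fun x => ?_)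
    by_cases hx : x.2 ∈ E <;> simp [hx]
  rw [conv, conv, hval (fun x => h x.2 * E.indicator (fun _ => (1 : ℝ)) x.2) (by fun_prop),
    hval (fun x => g x.1 * E.indicator (fun _ => (1 : ℝ)) x.2) (by fun_prop)]
  simp only [← mul_assoc]
  rw [integral_prod_symm _ (bdd _ ihφ), integral_prod_symm _ (bdd _ igφ)]
  refine integral_congr_ae ?_
  filter_upwards [key] with w hw
  simp only [integral_mul_const]
  rw [mul_comm _ (h w), hw]

theorem isGaussianProcess_of_map_sum_eq_gaussianReal {Ω T : Type*} [MeasurableSpace Ω]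
    {P : Measure Ω} {X : T → Ω → ℝ} (hX : ∀ t, Measurable (X t))
    (h : ∀ (m : ℕ) (ts : Fin m → T) (c : Fin m → ℝ),
      ∃ v : NNReal, P.map (fun ω => ∑ i, c i * X (ts i) ω) = gaussianReal 0 v) :
    IsGaussianProcess X P where
  hasGaussianLaw I := by
    constructor
    refine isGaussian_of_map_eq_gaussianReal fun L => ?_
    classical
    obtain ⟨v, hv⟩ := h (Fintype.card I) (fun i => ((Fintype.equivFin I).symm i : T))
      (fun i => L (Pi.single ((Fintype.equivFin I).symm i) 1))
    refine ⟨0, v, ?_⟩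
    rw [← hv, Measure.map_map (by fun_prop) (by fun_prop)]
    congr 1
    ext ω
    simp only [Function.comp_apply]
    rw [Equiv.sum_comp (Fintype.equivFin I).symm (fun i : I => L (Pi.single i 1) * X i ω)]
    conv_lhs => rw [pi_eq_sum_univ' (I.restrict fun t => X t ω)]
    simp only [map_sum]
    refine Finset.sum_congr rfl fun i _ => ?_
    simp [mul_comm]

/-- For a centered Gaussian process, the residuals of the `X (ts i)` on `X s` are independent of
the bridge value `X s - b * X r`, provided that the regression coefficients on `X s` also match
the covariances with `X r`. -/
theorem map_bridge_eq_prod {Ω ι T : Type*} [MeasurableSpace Ω] [Finite ι]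
    {P : Measure Ω} {X : T → Ω → ℝ} (hX : IsGaussianProcess X P)
    (hXm : ∀ t, Measurable (X t))
    (h0 : ∀ t, ∫ ω, X t ω ∂P = 0) (ts : ι → T) (s r : T) (a : ι → ℝ) (b : ℝ)
    (hs : ∀ i, ∫ ω, X (ts i) ω * X s ω ∂P = a i * ∫ ω, X s ω * X s ω ∂P)
    (hr : ∀ i, ∫ ω, X (ts i) ω * X r ω ∂P = a i * ∫ ω, X s ω * X r ω ∂P) :
    P.map (fun ω => (fun i => X (ts i) ω - a i * X s ω, X s ω - b * X r ω)) =
      (P.map fun ω i => X (ts i) ω - a i * X s ω).prod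
        (gaussianReal 0 (∫ ω, X s ω * X s ω ∂P - 2 * b * ∫ ω, X s ω * X r ω ∂P
          + b ^ 2 * ∫ ω, X r ω * X r ω ∂P).toNNReal) := by
  have := hX.isProbabilityMeasure
  have hL2 : ∀ t, MemLp (X t) 2 P := fun t => (hX.hasGaussianLaw_eval t).memLp_two
  have hi : ∀ t u, Integrable (fun ω => X t ω * X u ω) P := fun t u =>
    (hL2 t).integrable_mul (hL2 u)
  have hi1 : ∀ t, Integrable (X t) P := fun t => (hL2 t).integrable one_le_two
  let Y : ι ⊕ Unit → Ω → ℝ := Sum.elim (fun i ω => X (ts i) ω - a i * X s ω)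
    (fun _ ω => X s ω - b * X r ω)
  have hY : IsGaussianProcess Y P := by
    classical
    refine hX.of_isGaussianProcess ?_
    rintro (i | _)
    · refine ⟨{ts i, s}, ContinuousLinearMap.proj (R := ℝ) (φ := fun _ => ℝ) ⟨ts i, by simp⟩ -
        a i • ContinuousLinearMap.proj (R := ℝ) (φ := fun _ => ℝ) ⟨s, by simp⟩, fun ω => ?_⟩
      simp [Y]
    · refine ⟨{s, r}, ContinuousLinearMap.proj (R := ℝ) (φ := fun _ => ℝ) ⟨s, by simp⟩ -
        b • ContinuousLinearMap.proj (R := ℝ) (φ := fun _ => ℝ) ⟨r, by simp⟩, fun ω => ?_⟩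
      simp [Y]
  have hZ0 : ∫ ω, (X s ω - b * X r ω) ∂P = 0 := by
    rw [integral_sub (hi1 _) ((hi1 _).const_mul _), integral_const_mul, h0, h0]; simp
  have hL2Z : MemLp (fun ω => X s ω - b * X r ω) 2 P := (hL2 s).sub ((hL2 r).const_mul b)
  have hL2V : ∀ i, MemLp (fun ω => X (ts i) ω - a i * X s ω) 2 P :=
    fun i => (hL2 _).sub ((hL2 s).const_mul (a i))
  have hind := IsGaussianProcess.indepFun_of_covariance_eq_zero (P := P)
    (X := fun i ω => X (ts i) ω - a i * X s ω) (Y := fun (_ : Unit) ω => X s ω - b * X r ω) hY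
    (fun i => by fun_prop) (fun i => by fun_prop) (fun i _ => by
      rw [covariance_eq_sub (hL2V i) hL2Z, hZ0, mul_zero, sub_zero]
      have : ((fun ω => X (ts i) ω - a i * X s ω) * fun ω => X s ω - b * X r ω) =
          fun ω => (X (ts i) ω * X s ω - a i * (X s ω * X s ω)) -
            (b * (X (ts i) ω * X r ω - a i * (X s ω * X r ω))) := by
        ext ω; simp only [Pi.mul_apply]; ring
      have hi3 : ∀ t u v w, Integrable (fun ω => X t ω * X u ω - a i * (X v ω * X w ω)) P :=
        fun t u v w => (hi t u).sub ((hi v w).const_mul _)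
      rw [this, integral_sub (hi3 _ _ _ _) ((hi3 _ _ _ _).const_mul _), integral_const_mul,
        integral_sub (hi _ _) ((hi _ _).const_mul _), integral_sub (hi _ _) ((hi _ _).const_mul _),
        integral_const_mul, integral_const_mul, hs, hr]
      ring)
  have hind' := (hind.comp (φ := id) (ψ := fun y : Unit → ℝ => y ()) measurable_id
    (measurable_pi_apply ())).map_prod_eq_prod_map_map (by fun_prop) (by fun_prop)
  simp only [Function.comp_def, id] at hind'
  rw [hind']
  congr 1
  have hg : HasGaussianLaw (fun ω => X s ω - b * X r ω) P := hY.hasGaussianLaw_eval (Sum.inr ())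
  rw [hg.map_eq_gaussianReal, hZ0, variance_eq_sub hL2Z, hZ0]
  congr 2
  have : ((fun ω => X s ω - b * X r ω) ^ 2) =
      fun ω => (X s ω * X s ω - 2 * b * (X s ω * X r ω)) + b ^ 2 * (X r ω * X r ω) := by
    ext ω; simp only [Pi.pow_apply]; ring
  have hi2 : Integrable (fun ω => X s ω * X s ω - 2 * b * (X s ω * X r ω)) P :=
    (hi _ _).sub ((hi _ _).const_mul _)
  rw [this, integral_add hi2 ((hi _ _).const_mul _),
    integral_sub (hi _ _) ((hi _ _).const_mul _), integral_const_mul, integral_const_mul]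
  ring

/-- Disintegration of the joint law of `τ` and a functional of `τ` and an independent `Y`. -/
theorem measure_prodMk_mem_of_indepFun {Ω Ω' β γ : Type*} [MeasurableSpace Ω]
    [MeasurableSpace Ω'] [MeasurableSpace β] [MeasurableSpace γ] {P : Measure Ω}
    [IsFiniteMeasure P] {τ : Ω → β} {Y : Ω → Ω'} (hτ : Measurable τ) (hY : Measurable Y)
    (hind : IndepFun τ Y P) {f : β → Ω' → γ} (hf : Measurable (Function.uncurry f))
    {S : Set (β × γ)} (hS : MeasurableSet S) :
    P {ω | (τ ω, f (τ ω) (Y ω)) ∈ S} = ∫⁻ r, P {ω | (r, f r (Y ω)) ∈ S} ∂(P.map τ) := by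
  have hF : Measurable fun x : β × Ω' => (x.1, f x.1 x.2) := measurable_fst.prodMk hf
  have h1 := congrArg (fun m => m ((fun x : β × Ω' => (x.1, f x.1 x.2)) ⁻¹' S))
    (hind.map_prod_eq_prod_map_map hτ.aemeasurable hY.aemeasurable)
  beta_reduce at h1
  rw [Measure.map_apply (hτ.prodMk hY) (hF hS), Measure.prod_apply (hF hS)] at h1
  rw [show {ω | (τ ω, f (τ ω) (Y ω)) ∈ S} = (fun ω => (τ ω, Y ω)) ⁻¹'
    ((fun x : β × Ω' => (x.1, f x.1 x.2)) ⁻¹' S) from rfl, h1]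
  refine lintegral_congr fun r => ?_
  rw [Measure.map_apply hY (measurable_prodMk_left (hF hS))]
  rfl

theorem measure_prodMk_mem_of_indep {Ω β γ : Type*} {m mΩ : MeasurableSpace Ω}
    [MeasurableSpace β] [MeasurableSpace γ] {P : Measure Ω} [IsFiniteMeasure P] (hm : m ≤ mΩ)
    {τ : Ω → β} (hτ : Measurable τ)
    (hind : Indep (MeasurableSpace.comap τ inferInstance) m P)
    {f : β → Ω → γ} (hf : @Measurable _ _ (@Prod.instMeasurableSpace _ _ _ m) _
      (Function.uncurry f)) {S : Set (β × γ)} (hS : MeasurableSet S) :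
    P {ω | (τ ω, f (τ ω) ω) ∈ S} = ∫⁻ r, P {ω | (r, f r ω) ∈ S} ∂(P.map τ) := by
  refine @measure_prodMk_mem_of_indepFun Ω Ω β γ mΩ m _ _ P _ τ id hτ
    (measurable_id'' hm) ?_ f hf S hS
  refine (@IndepFun_iff_Indep Ω β Ω mΩ _ m τ id P).2 ?_
  rwa [@MeasurableSpace.comap_id Ω m]

theorem map_restrict_eq_withDensity_gaussianPDFReal {Ω 𝓥 : Type*} {m mΩ : MeasurableSpace Ω}
    [MeasurableSpace 𝓥] {P : Measure Ω} [IsFiniteMeasure P] (hm : m ≤ mΩ)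
    {τ : Ω → ℝ} (hτ : Measurable τ) (hind : Indep (MeasurableSpace.comap τ inferInstance) m P)
    {f : ℝ → Ω → 𝓥 × ℝ} (hf : @Measurable _ _ (@Prod.instMeasurableSpace _ _ _ m) _
      (Function.uncurry f)) {D : Set ℝ} (hD : MeasurableSet D) {ν : Measure 𝓥} [SFinite ν]
    {v : ℝ → NNReal} (hv : Measurable v) (hv0 : ∀ r ∈ D, v r ≠ 0)
    (hlaw : ∀ r ∈ D, P.map (f r) = ν.prod (gaussianReal 0 (v r))) :
    (P.restrict (τ ⁻¹' D)).map (fun ω => (τ ω, f (τ ω) ω)) =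
      (((P.map τ).restrict D).prod (ν.prod volume)).withDensity
        (fun x => ENNReal.ofReal (gaussianPDFReal 0 (v x.1) x.2.2)) := by
  have hfτ : Measurable fun ω => (τ ω, f (τ ω) ω) := by
    have h1 : @Measurable Ω (ℝ × Ω) mΩ (@Prod.instMeasurableSpace ℝ Ω _ m) fun ω => (τ ω, ω) :=
      @Measurable.prodMk Ω mΩ ℝ Ω _ m τ id hτ (measurable_id'' hm)
    exact hτ.prodMk (hf.comp h1)
  have hfr : ∀ r, Measurable (f r) := fun r => by
    have h1 : @Measurable Ω (ℝ × Ω) mΩ (@Prod.instMeasurableSpace ℝ Ω _ m) fun ω => (r, ω) :=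
      @Measurable.prodMk Ω mΩ ℝ Ω _ m (fun _ => r) id measurable_const (measurable_id'' hm)
    exact hf.comp h1
  have hφ : Measurable fun x : ℝ × (𝓥 × ℝ) =>
      ENNReal.ofReal (gaussianPDFReal 0 (v x.1) x.2.2) := by
    refine ENNReal.measurable_ofReal.comp (measurable_uncurry_gaussianPDFReal.comp
      (measurable_const.prodMk ((hv.comp measurable_fst).prodMk
        (measurable_snd.comp measurable_snd))))
  ext S hS
  have hS' : MeasurableSet (S ∩ (Prod.fst ⁻¹' D)) := hS.inter (measurable_fst hD)
  rw [Measure.map_apply hfτ hS, Measure.restrict_apply (hfτ hS),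
    withDensity_apply _ hS, ← lintegral_indicator hS,
    lintegral_prod _ (hφ.indicator hS).aemeasurable,
    show (fun ω => (τ ω, f (τ ω) ω)) ⁻¹' S ∩ τ ⁻¹' D =
      {ω | (τ ω, f (τ ω) ω) ∈ S ∩ (Prod.fst ⁻¹' D)} from rfl,
    measure_prodMk_mem_of_indep hm hτ hind hf hS', ← lintegral_indicator hD]
  refine lintegral_congr fun r => ?_
  by_cases hr : r ∈ D
  · rw [indicator_of_mem hr]
    have h1 : {ω | (r, f r ω) ∈ S ∩ (Prod.fst ⁻¹' D)} = f r ⁻¹' (Prod.mk r ⁻¹' S) := by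
      ext ω; simp [hr]
    have hSr : MeasurableSet (Prod.mk r ⁻¹' S) := measurable_prodMk_left hS
    rw [h1, ← Measure.map_apply (hfr r) hSr, hlaw r hr,
      gaussianReal_of_var_ne_zero 0 (hv0 r hr), prod_withDensity_right (measurable_gaussianPDF _ _),
      withDensity_apply _ hSr, ← lintegral_indicator hSr]
    rfl
  · rw [indicator_of_notMem hr]
    simp [hr]

/-- The data of a centered Gaussian process with continuous paths on `[0, ∞)` whose covariance
factorizes as `ρ (min s t) * q (max s t)` and is nondegenerate. -/
structure IsMarkovGaussian {Ω : Type*} [MeasurableSpace Ω] (P : Measure Ω) (X : ℝ → Ω → ℝ)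
    (ρ q : ℝ → ℝ) : Prop where
  measurable : ∀ t, Measurable (X t)
  gaussian : IsGaussianProcess (fun t : Ici (0 : ℝ) => X t) P
  centered : ∀ t, 0 ≤ t → ∫ ω, X t ω ∂P = 0
  cov : ∀ s t, 0 ≤ s → s ≤ t → ∫ ω, X s ω * X t ω ∂P = ρ s * q t
  continuousOn : ∀ ω, ContinuousOn (fun t => X t ω) (Ici 0)
  continuousOn_left : ContinuousOn ρ (Ici 0)
  continuousOn_right : ContinuousOn q (Ici 0)
  left_pos : ∀ t, 0 < t → 0 < ρ t
  det_pos : ∀ s r, 0 < s → s < r → 0 < ρ r * q s - ρ s * q r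

/-- The value at time `s` of the bridge of length `max r s`. -/
noncomputable def bridgeAt {Ω : Type*} (X : ℝ → Ω → ℝ) (ρ : ℝ → ℝ) (s r : ℝ) (ω : Ω) : ℝ :=
  X s ω - ρ s / ρ (max r s) * X (max r s) ω

theorem continuous_comp_max_of_continuousOn_Ici {u : ℝ → ℝ} (hu : ContinuousOn u (Ici 0))
    {s : ℝ} (hs : 0 < s) :
    Continuous fun r => u (max r s) :=
  hu.comp_continuous (by fun_prop) fun r => hs.le.trans (le_max_right r s)

theorem measurable_uncurry_bridgeAt {Ω : Type*} [MeasurableSpace Ω] {X : ℝ → Ω → ℝ} {ρ : ℝ → ℝ}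
    (hX : ∀ t, 0 ≤ t → Measurable (X t)) (hXc : ∀ ω, ContinuousOn (fun t => X t ω) (Ici 0))
    (hρ : ContinuousOn ρ (Ici 0)) (hρ0 : ∀ t, 0 < t → 0 < ρ t) {s : ℝ} (hs : 0 < s) :
    Measurable (Function.uncurry (bridgeAt X ρ s)) := by
  refine measurable_uncurry_of_continuous_of_measurable (fun ω => ?_) (fun r => ?_)
  · unfold bridgeAt
    exact continuous_const.sub ((continuous_const.div
      (continuous_comp_max_of_continuousOn_Ici hρ hs)
      fun r => (hρ0 _ (hs.trans_le (le_max_right r s))).ne').mul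
      (continuous_comp_max_of_continuousOn_Ici (hXc ω) hs))
  · unfold bridgeAt
    exact (hX s hs.le).sub ((hX _ (hs.le.trans (le_max_right r s))).const_mul _)

theorem measurable_uncurry_prodMk_bridgeAt {Ω ι : Type*} [MeasurableSpace Ω] {X : ℝ → Ω → ℝ}
    {ρ : ℝ → ℝ} (hX : ∀ t, 0 ≤ t → Measurable (X t))
    (hXc : ∀ ω, ContinuousOn (fun t => X t ω) (Ici 0))
    (hρ : ContinuousOn ρ (Ici 0)) (hρ0 : ∀ t, 0 < t → 0 < ρ t) {s : ℝ} (hs : 0 < s)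
    {ts : ι → ℝ} (hts : ∀ i, 0 ≤ ts i) :
    Measurable (Function.uncurry fun r ω =>
      (fun i => X (ts i) ω - ρ (ts i) / ρ s * X s ω, bridgeAt X ρ s r ω)) := by
  refine Measurable.prodMk ?_ (measurable_uncurry_bridgeAt hX hXc hρ hρ0 hs)
  refine measurable_pi_lambda _ fun i => ?_
  exact ((hX _ (hts i)).sub ((hX s hs.le).const_mul _)).comp measurable_snd

/-- The variance at time `s` of the bridge of length `max r s`. -/
noncomputable def bridgeVar (ρ q : ℝ → ℝ) (s r : ℝ) : NNReal :=
  (ρ s * q s - ρ s ^ 2 * q (max r s) / ρ (max r s)).toNNReal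

/-- Bayes' formula for the mean of `g` under the prior `μ` restricted to `D`, given the value `z`
at time `s` of a bridge of random length. -/
noncomputable def posteriorMean (μ : Measure ℝ) (ρ q : ℝ → ℝ) (D : Set ℝ) (s : ℝ) (g : ℝ → ℝ)
    (z : ℝ) : ℝ :=
  (∫ r in D, g r * gaussianPDFReal 0 (bridgeVar ρ q s r) z ∂μ) /
    ∫ r in D, gaussianPDFReal 0 (bridgeVar ρ q s r) z ∂μ

namespace IsMarkovGaussian

variable {Ω : Type*} [mΩ : MeasurableSpace Ω] {P : Measure Ω} {X : ℝ → Ω → ℝ} {ρ q : ℝ → ℝ}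

theorem left_max_pos (h : IsMarkovGaussian P X ρ q) {s : ℝ} (hs : 0 < s) (r : ℝ) :
    0 < ρ (max r s) := h.left_pos _ (hs.trans_le (le_max_right r s))

theorem measurable_bridgeVar (h : IsMarkovGaussian P X ρ q) {s : ℝ} (hs : 0 < s) :
    Measurable (bridgeVar ρ q s) := by
  have h1 := (continuous_comp_max_of_continuousOn_Ici h.continuousOn_left hs).measurable
  have h2 := (continuous_comp_max_of_continuousOn_Ici h.continuousOn_right hs).measurable
  exact (measurable_const.sub ((h2.const_mul _).div h1)).real_toNNReal

theorem coe_bridgeVar (h : IsMarkovGaussian P X ρ q) {s r : ℝ} (hs : 0 < s) (hr : s < r) :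
    (bridgeVar ρ q s r : ℝ) = ρ s * (ρ r * q s - ρ s * q r) / ρ r := by
  have h1 := h.left_pos s hs
  have h2 := h.left_pos r (hs.trans hr)
  have h3 := h.det_pos s r hs hr
  have h4 : ρ s * q s - ρ s ^ 2 * q r / ρ r = ρ s * (ρ r * q s - ρ s * q r) / ρ r := by
    field_simp
  rw [bridgeVar, max_eq_left hr.le, h4, Real.coe_toNNReal _ (by positivity)]

theorem coe_bridgeVar_pos (h : IsMarkovGaussian P X ρ q) {s r : ℝ} (hs : 0 < s) (hr : s < r) :
    (0 : ℝ) < bridgeVar ρ q s r := by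
  have h1 := h.left_pos s hs
  have h2 := h.left_pos r (hs.trans hr)
  have h3 := h.det_pos s r hs hr
  rw [h.coe_bridgeVar hs hr]
  positivity

theorem map_bridgeAt (h : IsMarkovGaussian P X ρ q) {ι : Type*} [Finite ι] {s r : ℝ} (hs : 0 < s)
    (hr : s < r) {ts : ι → ℝ} (hts : ∀ i, 0 ≤ ts i) (hts' : ∀ i, ts i ≤ s) :
    P.map (fun ω => (fun i => X (ts i) ω - ρ (ts i) / ρ s * X s ω, bridgeAt X ρ s r ω)) =
      (P.map fun ω i => X (ts i) ω - ρ (ts i) / ρ s * X s ω).prod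
        (gaussianReal 0 (bridgeVar ρ q s r)) := by
  have h1 := h.left_pos s hs
  have h2 := h.left_pos r (hs.trans hr)
  have key := map_bridge_eq_prod h.gaussian (fun t => h.measurable t)
    (fun t => h.centered t t.2) (fun i => ⟨ts i, hts i⟩) ⟨s, hs.le⟩ ⟨r, (hs.trans hr).le⟩
    (fun i => ρ (ts i) / ρ s) (ρ s / ρ r)
    (fun i => by
      simp only
      rw [h.cov _ _ (hts i) (hts' i), h.cov _ _ hs.le le_rfl]
      field_simp)
    (fun i => by
      simp only
      rw [h.cov _ _ (hts i) ((hts' i).trans hr.le), h.cov _ _ hs.le hr.le]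
      field_simp)
  simp only at key
  simp only [bridgeAt, bridgeVar, max_eq_left hr.le]
  rw [key, h.cov _ _ hs.le le_rfl, h.cov _ _ hs.le hr.le, h.cov _ _ (hs.trans hr).le le_rfl]
  congr 3
  field_simp
  ring

theorem map_restrict_bridgeAt (h : IsMarkovGaussian P X ρ q) [IsProbabilityMeasure P]
    {τ : Ω → ℝ} (hτ : Measurable τ)
    (hind : Indep (MeasurableSpace.comap τ inferInstance)
      (⨆ t ∈ Ici (0:ℝ), MeasurableSpace.comap (X t) inferInstance) P)
    {ι : Type*} [Finite ι] {s : ℝ} (hs : 0 < s) {ts : ι → ℝ} (hts : ∀ i, 0 ≤ ts i)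
    (hts' : ∀ i, ts i ≤ s) {D : Set ℝ} (hD : MeasurableSet D) (hDs : D ⊆ Ioi s) :
    (P.restrict (τ ⁻¹' D)).map (fun ω => (τ ω,
        (fun i => X (ts i) ω - ρ (ts i) / ρ s * X s ω, bridgeAt X ρ s (τ ω) ω))) =
      (((P.map τ).restrict D).prod
        ((P.map fun ω i => X (ts i) ω - ρ (ts i) / ρ s * X s ω).prod volume)).withDensity
        (fun x => ENNReal.ofReal (gaussianPDFReal 0 (bridgeVar ρ q s x.1) x.2.2)) := by
  have hXm : ∀ t, 0 ≤ t → Measurable[⨆ t ∈ Ici (0:ℝ),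
      MeasurableSpace.comap (X t) inferInstance] (X t) := fun t ht =>
    measurable_iff_comap_le.2 (le_iSup₂ (f := fun t (_ : t ∈ Ici (0:ℝ)) =>
      MeasurableSpace.comap (X t) inferInstance) t ht)
  refine map_restrict_eq_withDensity_gaussianPDFReal
    (iSup₂_le fun t _ => (h.measurable t).comap_le) hτ hind
    (f := fun r ω => (fun i => X (ts i) ω - ρ (ts i) / ρ s * X s ω, bridgeAt X ρ s r ω))
    ?_ hD (h.measurable_bridgeVar hs)
    (fun r hr => ?_) fun r hr => h.map_bridgeAt hs (hDs hr) hts hts'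
  · exact @measurable_uncurry_prodMk_bridgeAt Ω ι (⨆ t ∈ Ici (0:ℝ),
      MeasurableSpace.comap (X t) inferInstance) X ρ hXm h.continuousOn h.continuousOn_left
      h.left_pos s hs ts hts
  · have := h.coe_bridgeVar_pos hs (hDs hr)
    exact_mod_cast this.ne'

end IsMarkovGaussian

theorem bridgeAt_eq_zero {Ω : Type*} (X : ℝ → Ω → ℝ) {ρ : ℝ → ℝ} {s r : ℝ} (hρ : ρ s ≠ 0)
    (hr : r ≤ s) (ω : Ω) : bridgeAt X ρ s r ω = 0 := by
  simp [bridgeAt, max_eq_right hr, hρ]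

theorem posteriorMean_eq_setIntegral {μ : Measure ℝ} {ρ q : ℝ → ℝ} {D : Set ℝ}
    (hD : MeasurableSet D) {s z K : ℝ} (hK : K ≠ 0) {w : ℝ → ℝ}
    (hw : ∀ r ∈ D, w r = K * gaussianPDFReal 0 (bridgeVar ρ q s r) z) (g : ℝ → ℝ) :
    ∫ r in D, g r * (w r / ∫ r in D, w r ∂μ) ∂μ = posteriorMean μ ρ q D s g z := by
  simp only [← mul_div_assoc]
  rw [integral_div, setIntegral_congr_fun hD hw, integral_const_mul,
    setIntegral_congr_fun (g := fun r => K * (g r * gaussianPDFReal 0 (bridgeVar ρ q s r) z)) hD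
      fun r hr => by simp only [hw r hr]; ring, integral_const_mul,
    mul_div_mul_left _ _ hK, posteriorMean]

namespace IsMarkovGaussian

variable {Ω : Type*} [mΩ : MeasurableSpace Ω] {P : Measure Ω} {X : ℝ → Ω → ℝ} {ρ q : ℝ → ℝ}

theorem measurable_gaussianPDFReal_bridgeVar (h : IsMarkovGaussian P X ρ q) {s : ℝ} (hs : 0 < s) :
    Measurable fun x : ℝ × ℝ => gaussianPDFReal 0 (bridgeVar ρ q s x.1) x.2 :=
  measurable_uncurry_gaussianPDFReal.comp (measurable_const.prodMk
    (((h.measurable_bridgeVar hs).comp measurable_fst).prodMk measurable_snd))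

theorem measurable_posteriorMean (h : IsMarkovGaussian P X ρ q) {μ : Measure ℝ} [SFinite μ]
    {s : ℝ} (hs : 0 < s) (D : Set ℝ) {g : ℝ → ℝ} (hg : Measurable g) :
    Measurable (posteriorMean μ ρ q D s g) := by
  have hφ := h.measurable_gaussianPDFReal_bridgeVar hs
  refine Measurable.div ?_ ?_
  · exact (StronglyMeasurable.integral_prod_left' (μ := μ.restrict D)
      (f := fun x : ℝ × ℝ => g x.1 * gaussianPDFReal 0 (bridgeVar ρ q s x.1) x.2)
      ((hg.comp measurable_fst).mul hφ).stronglyMeasurable).measurable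
  · exact (StronglyMeasurable.integral_prod_left' (μ := μ.restrict D)
      hφ.stronglyMeasurable).measurable

theorem measurable_bridgeAt_comp (h : IsMarkovGaussian P X ρ q) {τ : Ω → ℝ} (hτ : Measurable τ)
    {s : ℝ} (hs : 0 < s) : Measurable fun ω => bridgeAt X ρ s (τ ω) ω :=
  (measurable_uncurry_bridgeAt (fun t _ => h.measurable t) h.continuousOn h.continuousOn_left
    h.left_pos hs).comp (hτ.prodMk measurable_id)

theorem ae_bridgeAt_ne_zero (h : IsMarkovGaussian P X ρ q) [IsProbabilityMeasure P]
    {τ : Ω → ℝ} (hτ : Measurable τ)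
    (hind : Indep (MeasurableSpace.comap τ inferInstance)
      (⨆ t ∈ Ici (0:ℝ), MeasurableSpace.comap (X t) inferInstance) P) {s : ℝ} (hs : 0 < s) :
    ∀ᵐ ω ∂P, s < τ ω → bridgeAt X ρ s (τ ω) ω ≠ 0 := by
  have hlaw := h.map_restrict_bridgeAt hτ hind hs (ts := fun i : Fin 0 => i.elim0)
    (fun i => i.elim0) (fun i => i.elim0) measurableSet_Ioi subset_rfl
  have hac := withDensity_absolutelyContinuous (((P.map τ).restrict (Ioi s)).prod
    ((P.map fun ω (i : Fin 0) => X i.elim0 ω - ρ i.elim0 / ρ s * X s ω).prod volume))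
    (fun x : ℝ × (Fin 0 → ℝ) × ℝ => ENNReal.ofReal (gaussianPDFReal 0 (bridgeVar ρ q s x.1) x.2.2))
  have hnull : (((P.map τ).restrict (Ioi s)).prod
      ((P.map fun ω (i : Fin 0) => X i.elim0 ω - ρ i.elim0 / ρ s * X s ω).prod volume))
      (univ ×ˢ (univ ×ˢ {(0:ℝ)})) = 0 := by
    rw [Measure.prod_prod, Measure.prod_prod]; simp
  have h1 := hac hnull
  have hS : MeasurableSet ((univ : Set ℝ) ×ˢ ((univ : Set (Fin 0 → ℝ)) ×ˢ {(0:ℝ)})) :=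
    MeasurableSet.univ.prod (MeasurableSet.univ.prod (measurableSet_singleton 0))
  rw [← hlaw, Measure.map_apply _ hS, Measure.restrict_apply'
    (hτ measurableSet_Ioi)] at h1
  · rw [ae_iff]
    convert h1 using 2
    ext ω
    simp [and_comm]
  · refine hτ.prodMk (Measurable.prodMk (measurable_pi_lambda _ fun i => i.elim0)
      (h.measurable_bridgeAt_comp hτ hs))

theorem integrableOn_posteriorMean_and_setIntegral_eq (h : IsMarkovGaussian P X ρ q)
    [IsProbabilityMeasure P] {τ : Ω → ℝ} (hτ : Measurable τ)
    (hind : Indep (MeasurableSpace.comap τ inferInstance)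
      (⨆ t ∈ Ici (0:ℝ), MeasurableSpace.comap (X t) inferInstance) P)
    {ι : Type*} [Finite ι] {u : ι → ℝ} (hu : ∀ i, 0 < u i) {s : ℝ} (hs : 0 < s)
    {D : Set ℝ} (hD : MeasurableSet D) (hDs : D ⊆ Ioi s) (hDu : ∀ i, u i ≤ s ∨ D ⊆ Iic (u i))
    {g : ℝ → ℝ} (hg : Measurable g) (hgτ : Integrable (fun ω => g (τ ω)) P) :
    IntegrableOn (fun ω => posteriorMean (P.map τ) ρ q D s g (bridgeAt X ρ s (τ ω) ω))
      (τ ⁻¹' D) P ∧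
    ∀ E, MeasurableSet E →
      ∫ ω in (fun ω i => bridgeAt X ρ (u i) (τ ω) ω) ⁻¹' E ∩ τ ⁻¹' D,
          posteriorMean (P.map τ) ρ q D s g (bridgeAt X ρ s (τ ω) ω) ∂P =
        ∫ ω in (fun ω i => bridgeAt X ρ (u i) (τ ω) ω) ⁻¹' E ∩ τ ⁻¹' D, g (τ ω) ∂P := by
  have hτP : IsProbabilityMeasure (P.map τ) := Measure.isProbabilityMeasure_map hτ.aemeasurable
  have hlaw := h.map_restrict_bridgeAt hτ hind hs (ts := fun i => min (u i) s)
    (fun i => (lt_min (hu i) hs).le) (fun i => min_le_right _ _) hD hDs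
  set W : Ω → (ι → ℝ) × ℝ := fun ω =>
    (fun i => X (min (u i) s) ω - ρ (min (u i) s) / ρ s * X s ω, bridgeAt X ρ s (τ ω) ω) with hW
  have hWm : Measurable W := by
    refine Measurable.prodMk (measurable_pi_lambda _ fun i => ?_) (h.measurable_bridgeAt_comp hτ hs)
    exact (h.measurable _).sub ((h.measurable _).const_mul _)
  have hφ : Measurable fun x : ℝ × (ι → ℝ) × ℝ =>
      gaussianPDFReal 0 (bridgeVar ρ q s x.1) x.2.2 :=
    (h.measurable_gaussianPDFReal_bridgeVar hs).comp (f := fun x : ℝ × (ι → ℝ) × ℝ => (x.1, x.2.2))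
      (measurable_fst.prodMk (measurable_snd.comp measurable_snd))
  have key := integrable_posteriorMean_and_setIntegral_eq (Q := P.restrict (τ ⁻¹' D)) hτ hWm
    (φ := fun r w => gaussianPDFReal 0 (bridgeVar ρ q s r) w.2) hφ
    (fun r w => gaussianPDFReal_nonneg _ _ _) hlaw hg hgτ.integrableOn
  refine ⟨key.1, fun E hE => ?_⟩
  classical
  let Φ : (ι → ℝ) × ℝ → ι → ℝ := fun w i =>
    if u i ≤ s then w.1 i + ρ (u i) / ρ s * w.2 else 0
  have hΦ : Measurable Φ := by
    refine measurable_pi_lambda _ fun i => ?_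
    by_cases hi : u i ≤ s
    · simp only [Φ, hi, if_true]; fun_prop
    · simp only [Φ, hi, if_false]; fun_prop
  have hset : (fun ω i => bridgeAt X ρ (u i) (τ ω) ω) ⁻¹' E ∩ τ ⁻¹' D =
      W ⁻¹' (Φ ⁻¹' E) ∩ τ ⁻¹' D := by
    ext ω
    simp only [mem_inter_iff, mem_preimage]
    refine and_congr_left fun hω => ?_
    have : (fun i => bridgeAt X ρ (u i) (τ ω) ω) = Φ (W ω) := by
      ext i
      have hsτ : s < τ ω := hDs hω
      by_cases hi : u i ≤ s
      · have h1 := (h.left_pos s hs).ne'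
        simp only [Φ, hi, if_true, hW, bridgeAt, min_eq_left hi, max_eq_left hsτ.le,
          max_eq_left (hi.trans hsτ.le)]
        field_simp
        ring
      · simp only [Φ, hi, if_false]
        exact bridgeAt_eq_zero X (h.left_pos _ (hu i)).ne' ((hDu i).resolve_left hi hω) ω
    rw [this]
  have := key.2 _ (hΦ hE)
  rw [Measure.restrict_restrict (hWm (hΦ hE))] at this
  rw [hset]
  exact this

end IsMarkovGaussian

theorem sum_indicator_partition {n : ℕ} (hn : 1 ≤ n) {t : ℕ → ℝ}
    (ht : ∀ i j, 1 ≤ i → i < j → j ≤ n → t i < t j) (x : ℝ) :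
    (if x ≤ t 1 then (1 : ℝ) else 0) +
      ∑ k ∈ Finset.Icc 1 (n - 1), (if x ∈ Ioc (t k) (t (k + 1)) then (1 : ℝ) else 0) +
      (if x ∈ Ioi (t n) then (1 : ℝ) else 0) = 1 := by
  induction n, hn using Nat.le_induction with
  | base => by_cases h : x ≤ t 1 <;> simp [h, not_lt.2, not_le.1]
  | succ n hn ih =>
    have h1 := ih fun i j hi hij hj => ht i j hi hij (hj.trans n.le_succ)
    have h2 := ht n (n + 1) hn n.lt_succ_self le_rfl
    obtain ⟨m, rfl⟩ : ∃ m, n = m + 1 := ⟨n - 1, by omega⟩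
    simp only [Nat.add_sub_cancel] at h1 ⊢
    rw [Finset.sum_Icc_succ_top (by omega)]
    have h3 : (if x ∈ Ioi (t (m + 1)) then (1 : ℝ) else 0) =
        (if x ∈ Ioc (t (m + 1)) (t (m + 1 + 1)) then (1 : ℝ) else 0) +
          if x ∈ Ioi (t (m + 1 + 1)) then (1 : ℝ) else 0 := by
      simp only [mem_Ioc, mem_Ioi]
      by_cases h4 : t (m + 1) < x <;> by_cases h5 : x ≤ t (m + 1 + 1)
      · simp [h4, h5]
      · simp [h4, h5, not_le.1 h5]
      · simp [h4, h5]
      · exact absurd (h2.trans (not_le.1 h5)) h4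
    linarith

/-- The conditional expectation of `g ∘ τ` given the values at finitely many times of the bridge
of random length `τ`. -/
theorem IsMarkovGaussian.condExp_length {Ω : Type*} {m mΩ : MeasurableSpace Ω} {P : Measure Ω}
    {X : ℝ → Ω → ℝ} {ρ q : ℝ → ℝ} (h : IsMarkovGaussian P X ρ q)
    [IsProbabilityMeasure P] {τ : Ω → ℝ} (hτ : Measurable τ) (hτ0 : ∀ ω, 0 < τ ω)
    (hind : Indep (MeasurableSpace.comap τ inferInstance)
      (⨆ t ∈ Ici (0:ℝ), MeasurableSpace.comap (X t) inferInstance) P)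
    {n : ℕ} (hn : 1 ≤ n) {t : ℕ → ℝ} (ht : ∀ i j, 1 ≤ i → i < j → j ≤ n → t i < t j)
    (ht1 : 0 < t 1) (hP : P.real (τ ⁻¹' Iic (t 1)) ≠ 0)
    {g : ℝ → ℝ} (hg : Measurable g) (hgτ : Integrable (fun ω => g (τ ω)) P)
    {Z : ℕ → Ω → ℝ} (hZ : ∀ k, Z k = fun ω => bridgeAt X ρ (t k) (τ ω) ω)
    (hm_eq : m = ⨆ k ∈ Finset.Icc 1 n, MeasurableSpace.comap (Z k) inferInstance) :
    P[(fun ω => g (τ ω))|m] =ᵐ[P]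
      fun ω => (∫ r in Ioc (0:ℝ) (t 1), g r ∂(P.map τ)) / P.real (τ ⁻¹' Iic (t 1)) *
          (if Z 1 ω = 0 then 1 else 0)
        + ∑ k ∈ Finset.Icc 1 (n - 1),
            posteriorMean (P.map τ) ρ q (Ioc (t k) (t (k + 1))) (t k) g (Z k ω) *
              (if Z k ω ≠ 0 ∧ Z (k + 1) ω = 0 then 1 else 0)
        + posteriorMean (P.map τ) ρ q (Ioi (t n)) (t n) g (Z n ω) *
            (if Z n ω ≠ 0 then 1 else 0) := by
  have hτP : IsProbabilityMeasure (P.map τ) := Measure.isProbabilityMeasure_map hτ.aemeasurable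
  have htle : ∀ i j, 1 ≤ i → i ≤ j → j ≤ n → t i ≤ t j := fun i j hi hij hj =>
    hij.eq_or_lt.elim (fun e => e ▸ le_rfl) fun e => (ht i j hi e hj).le
  have htpos : ∀ k ∈ Finset.Icc 1 n, 0 < t k := fun k hk => by
    rw [Finset.mem_Icc] at hk
    exact ht1.trans_le (htle 1 k le_rfl hk.1 hk.2)
  have hZm : ∀ k ∈ Finset.Icc 1 n, Measurable (Z k) := fun k hk => by
    rw [hZ]; exact h.measurable_bridgeAt_comp hτ (htpos k hk)
  have hm : m ≤ mΩ := hm_eq ▸ iSup₂_le fun k hk => (hZm k hk).comap_le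
  have hZm' : ∀ k ∈ Finset.Icc 1 n, Measurable[m] (Z k) := fun k hk =>
    measurable_iff_comap_le.2 (hm_eq ▸ le_iSup₂ (f := fun k (_ : k ∈ Finset.Icc 1 n) =>
      MeasurableSpace.comap (Z k) inferInstance) k hk)
  have hZ0 : ∀ᵐ ω ∂P, ∀ k ∈ Finset.Icc 1 n, (Z k ω = 0 ↔ τ ω ≤ t k) := by
    refine (ae_ball_iff (Finset.countable_toSet (Finset.Icc 1 n))).2 fun k hk => ?_
    filter_upwards [h.ae_bridgeAt_ne_zero hτ hind (htpos k hk)] with ω hω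
    rw [hZ]
    refine ⟨fun h0 => not_lt.1 fun hlt => hω hlt h0, fun hle => ?_⟩
    exact bridgeAt_eq_zero X (h.left_pos _ (htpos k hk)).ne' hle ω
  have hsub : ∀ k ∈ Finset.Icc 1 (n - 1), k ∈ Finset.Icc 1 n ∧ k + 1 ∈ Finset.Icc 1 n :=
    fun k hk => by simp only [Finset.mem_Icc] at hk ⊢; omega
  have hnn : n ∈ Finset.Icc 1 n := Finset.mem_Icc.2 ⟨hn, le_rfl⟩
  have h11 : 1 ∈ Finset.Icc 1 n := Finset.mem_Icc.2 ⟨le_rfl, hn⟩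
  set Y : Ω → Finset.Icc 1 n → ℝ := fun ω i => bridgeAt X ρ (t i) (τ ω) ω
  have hmY : m ≤ MeasurableSpace.comap Y inferInstance := by
    refine hm_eq ▸ iSup₂_le fun k hk => ?_
    have h1 : Measurable[MeasurableSpace.comap Y inferInstance] (Z k) := by
      rw [hZ]
      exact (measurable_pi_apply (⟨k, hk⟩ : Finset.Icc 1 n)).comp (comap_measurable Y)
    exact h1.comap_le
  set C : ℝ := (∫ r in Ioc (0:ℝ) (t 1), g r ∂(P.map τ)) / P.real (τ ⁻¹' Iic (t 1)) with hC
  set H : Set ℝ → ℕ → ℝ → ℝ := fun D k => posteriorMean (P.map τ) ρ q D (t k) g with hH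
  have hHm : ∀ D, ∀ k ∈ Finset.Icc 1 n, Measurable (H D k) := fun D k hk =>
    h.measurable_posteriorMean (htpos k hk) D hg
  set f : Ω → ℝ := fun ω => C * (if Z 1 ω = 0 then 1 else 0)
        + ∑ k ∈ Finset.Icc 1 (n - 1), H (Ioc (t k) (t (k + 1))) k (Z k ω) *
              (if Z k ω ≠ 0 ∧ Z (k + 1) ω = 0 then 1 else 0)
        + H (Ioi (t n)) n (Z n ω) * (if Z n ω ≠ 0 then 1 else 0) with hf
  have hzero : ∀ k ∈ Finset.Icc 1 n, MeasurableSet[m] {ω | Z k ω = 0} := fun k hk =>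
    hZm' k hk (measurableSet_singleton 0)
  have hfm : Measurable[m] f := by
    refine Measurable.add (Measurable.add ?_ (Finset.measurable_fun_sum _ fun k hk => ?_)) ?_
    · exact (Measurable.ite (hzero 1 h11) measurable_const measurable_const).const_mul C
    · obtain ⟨hk, hk'⟩ := hsub k hk
      exact ((hHm _ k hk).comp (hZm' k hk)).mul (Measurable.ite
        ((hzero k hk).compl.inter (hzero (k + 1) hk')) measurable_const measurable_const)
    · exact ((hHm _ n hnn).comp (hZm' n hnn)).mul (Measurable.ite
        (hzero n hnn).compl measurable_const measurable_const)
  -- the defect `f - g ∘ τ`, split according to the position of `τ` among the times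
  let e₀ : Ω → ℝ := (τ ⁻¹' Iic (t 1)).indicator fun ω => C - g (τ ω)
  let e : Set ℝ → ℕ → Ω → ℝ := fun D k =>
    (τ ⁻¹' D).indicator fun ω => H D k (Z k ω) - g (τ ω)
  have hfe : (fun ω => f ω - g (τ ω)) =ᵐ[P] fun ω => e₀ ω +
      ∑ k ∈ Finset.Icc 1 (n - 1), e (Ioc (t k) (t (k + 1))) k ω + e (Ioi (t n)) n ω := by
    filter_upwards [hZ0] with ω hω
    have h1 := sum_indicator_partition hn ht (τ ω)
    have h2 : g (τ ω) = g (τ ω) * (if τ ω ≤ t 1 then (1 : ℝ) else 0) +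
        ∑ k ∈ Finset.Icc 1 (n - 1), g (τ ω) *
          (if τ ω ∈ Ioc (t k) (t (k + 1)) then (1 : ℝ) else 0) +
        g (τ ω) * (if τ ω ∈ Ioi (t n) then (1 : ℝ) else 0) := by
      rw [← Finset.mul_sum, ← mul_add, ← mul_add, h1, mul_one]
    rw [h2, hf]
    simp only [add_sub_add_comm, ← Finset.sum_sub_distrib]
    congr 1
    · congr 1
      · by_cases h3 : τ ω ≤ t 1 <;> simp [e₀, hω 1 h11, h3]
      · refine Finset.sum_congr rfl fun k hk => ?_
        obtain ⟨hk, hk'⟩ := hsub k hk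
        by_cases h3 : t k < τ ω ∧ τ ω ≤ t (k + 1) <;> simp [e, hω k hk, hω _ hk', h3]
    · by_cases h3 : t n < τ ω <;> simp [e, hω n hnn, h3]
  have he₀ : Integrable e₀ P ∧ ∀ s, MeasurableSet[m] s → ∫ ω in s, e₀ ω ∂P = 0 := by
    have hA : MeasurableSet (τ ⁻¹' Iic (t 1)) := hτ measurableSet_Iic
    have hint : IntegrableOn (fun ω => C - g (τ ω)) (τ ⁻¹' Iic (t 1)) P :=
      (integrable_const C).integrableOn.sub hgτ.integrableOn
    refine ⟨(integrable_indicator_iff hA).2 hint, fun s hs => ?_⟩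
    obtain ⟨E, hE, rfl⟩ := hmY s hs
    rw [setIntegral_indicator hA]
    have hY0 : ∀ ω ∈ τ ⁻¹' Iic (t 1), Y ω = 0 := fun ω hω => by
      ext i
      exact bridgeAt_eq_zero X (h.left_pos _ (htpos i i.2)).ne'
        (hω.trans (htle 1 i le_rfl (Finset.mem_Icc.1 i.2).1 (Finset.mem_Icc.1 i.2).2)) ω
    by_cases h0 : (0 : Finset.Icc 1 n → ℝ) ∈ E
    · have h1 : Y ⁻¹' E ∩ τ ⁻¹' Iic (t 1) = τ ⁻¹' Iic (t 1) :=
        inter_eq_right.2 fun ω hω => by rwa [mem_preimage, hY0 ω hω]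
      have h2 : τ ⁻¹' Ioc 0 (t 1) = τ ⁻¹' Iic (t 1) := by
        ext ω; simp [hτ0 ω]
      rw [h1, integral_sub (integrable_const C).integrableOn hgτ.integrableOn, setIntegral_const,
        hC, setIntegral_map measurableSet_Ioc hg.aestronglyMeasurable hτ.aemeasurable, h2,
        smul_eq_mul, mul_div_cancel₀ _ hP, sub_self]
    · have h1 : Y ⁻¹' E ∩ τ ⁻¹' Iic (t 1) = ∅ :=
        eq_empty_of_forall_notMem fun ω hω => h0 (by simpa [hY0 ω hω.2] using hω.1)
      simp [h1]
  have he : ∀ D k, k ∈ Finset.Icc 1 n → MeasurableSet D → D ⊆ Ioi (t k) →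
      (∀ i ∈ Finset.Icc 1 n, i ≤ k ∨ D ⊆ Iic (t i)) →
      Integrable (e D k) P ∧ ∀ s, MeasurableSet[m] s → ∫ ω in s, e D k ω ∂P = 0 := by
    intro D k hk hD hDk hDi
    obtain ⟨h1, h2⟩ := h.integrableOn_posteriorMean_and_setIntegral_eq hτ hind
      (u := fun i : Finset.Icc 1 n => t i) (fun i => htpos i i.2) (htpos k hk) hD hDk
      (fun i => (hDi i i.2).imp_left fun hik =>
        htle i k (Finset.mem_Icc.1 i.2).1 hik (Finset.mem_Icc.1 hk).2) hg hgτ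
    have h1' : IntegrableOn (fun ω => H D k (Z k ω)) (τ ⁻¹' D) P := by
      simpa only [hH, hZ] using h1
    refine ⟨(integrable_indicator_iff (hτ hD)).2 (h1'.sub hgτ.integrableOn), fun s hs => ?_⟩
    obtain ⟨E, hE, rfl⟩ := hmY s hs
    rw [setIntegral_indicator (hτ hD), integral_sub (h1'.mono_set inter_subset_right)
      hgτ.integrableOn, sub_eq_zero]
    simpa only [hH, hZ] using h2 E hE
  have heI : ∀ k ∈ Finset.Icc 1 (n - 1), Integrable (e (Ioc (t k) (t (k + 1))) k) P ∧
      ∀ s, MeasurableSet[m] s → ∫ ω in s, e (Ioc (t k) (t (k + 1))) k ω ∂P = 0 := fun k hk => by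
    obtain ⟨hk, hk'⟩ := hsub k hk
    refine he _ k hk measurableSet_Ioc (fun r hr => hr.1) fun i hi => ?_
    refine (le_or_gt i k).imp_right fun hki r hr => hr.2.trans ?_
    exact htle _ _ (Finset.mem_Icc.1 hk').1 hki (Finset.mem_Icc.1 hi).2
  have hen := he (Ioi (t n)) n hnn measurableSet_Ioi subset_rfl
    fun i hi => Or.inl (Finset.mem_Icc.1 hi).2
  have hsum : Integrable (fun ω => ∑ k ∈ Finset.Icc 1 (n - 1), e (Ioc (t k) (t (k + 1))) k ω) P :=
    integrable_finsetSum _ fun k hk => (heI k hk).1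
  have hadd : Integrable (fun ω => e₀ ω +
      ∑ k ∈ Finset.Icc 1 (n - 1), e (Ioc (t k) (t (k + 1))) k ω) P := he₀.1.add hsum
  have hfg : Integrable (fun ω => f ω - g (τ ω)) P :=
    (hadd.add hen.1).congr hfe.symm
  have hfi : Integrable f P := by
    refine (hfg.add hgτ).congr (.of_forall fun ω => ?_)
    simp
  refine (ae_eq_condExp_of_forall_setIntegral_eq hm hgτ (fun s _ _ => hfi.integrableOn)
    (fun s hs _ => ?_) hfm.stronglyMeasurable.aestronglyMeasurable).symm
  rw [← sub_eq_zero, ← integral_sub hfi.integrableOn hgτ.integrableOn,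
    integral_congr_ae (ae_restrict_of_ae hfe),
    integral_add hadd.integrableOn hen.1.integrableOn,
    integral_add he₀.1.integrableOn hsum.integrableOn,
    integral_finsetSum _ fun k hk => (heI k hk).1.integrableOn, he₀.2 s hs, hen.2 s hs,
    Finset.sum_eq_zero fun k hk => (heI k hk).2 s hs]
  simp

namespace IsMarkovGaussian

variable {Ω : Type*} [mΩ : MeasurableSpace Ω] {P : Measure Ω} {X : ℝ → Ω → ℝ} {ρ q : ℝ → ℝ}

theorem sqrt_mul_exp_eq_mul_gaussianPDFReal (h : IsMarkovGaussian P X ρ q) {s r c κ : ℝ}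
    (hs : 0 < s) (hr : s < r)
    (hc : c = ρ r / (ρ s * (ρ r * q s - ρ s * q r)) - κ) (z : ℝ) :
    √(ρ r / (ρ r * q s - ρ s * q r)) * rexp (-(1 / 2) * c * z ^ 2) =
      √(2 * π * ρ s) * rexp (κ * z ^ 2 / 2) * gaussianPDFReal 0 (bridgeVar ρ q s r) z := by
  have h1 := h.left_pos s hs
  have h2 := h.left_pos r (hs.trans hr)
  have h3 := h.det_pos s r hs hr
  have h4 := h.coe_bridgeVar hs hr
  have h5 : ρ r / (ρ r * q s - ρ s * q r) = 2 * π * ρ s / (2 * π * bridgeVar ρ q s r) := by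
    rw [h4]; field_simp
  rw [gaussianPDFReal, h5, Real.sqrt_div (by positivity), hc, h4]
  have h6 : -(1 / 2) * (ρ r / (ρ s * (ρ r * q s - ρ s * q r)) - κ) * z ^ 2 =
      κ * z ^ 2 / 2 + -(z - 0) ^ 2 / (2 * (ρ s * (ρ r * q s - ρ s * q r) / ρ r)) := by
    field_simp
    ring
  rw [h6, Real.exp_add]
  ring

end IsMarkovGaussian

/-- Multi-time Bayes estimate of τ: for 0 < t_1 < … < t_n with F(t_1) > 0 and
E[|g(τ)|] < ∞, E[g(τ) | σ(ξ_{t_1}, …, ξ_{t_n})] has the explicit three-part form. -/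
theorem stmt_12
    {Ω : Type*} [MeasurableSpace Ω] (P : Measure Ω) [IsProbabilityMeasure P]
    (X : ℝ → Ω → ℝ)
    (hXmeas : ∀ t, Measurable (X t))
    (hGauss : ∀ (m : ℕ) (ts : Fin m → ℝ), (∀ i, 0 ≤ ts i) → ∀ c : Fin m → ℝ,
      ∃ v : NNReal, Measure.map (fun ω => ∑ i, c i * X (ts i) ω) P = gaussianReal 0 v)
    (hXcont : ∀ ω, ContinuousOn (fun t => X t ω) (Set.Ici 0))
    (hX0 : ∀ᵐ ω ∂P, X 0 ω = 0)
    (R : ℝ → ℝ → ℝ)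
    (hR : ∀ s t, R s t = ∫ ω, X s ω * X t ω ∂P)
    (hRpos : ∀ t, 0 < t → 0 < R t t)
    (hRnd : ∀ s t, 0 < s → 0 < t → s ≠ t → (R s t)^2 < R s s * R t t)
    (ξr : ℝ → ℝ → Ω → ℝ)
    (hξr : ∀ r t ω, ξr r t ω = X t ω - R t (max r t) / R (max r t) (max r t) * X (max r t) ω)
    (τ : Ω → ℝ) (hτmeas : Measurable τ) (hτpos : ∀ ω, 0 < τ ω)
    (hindep : Indep (MeasurableSpace.comap τ inferInstance)
      (⨆ t ∈ Set.Ici (0:ℝ), MeasurableSpace.comap (X t) inferInstance) P)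
    (F : ℝ → ℝ) (hF : ∀ t, F t = (P {ω | τ ω ≤ t}).toReal)
    (ξ : ℝ → Ω → ℝ) (hξ : ∀ t ω, ξ t ω = ξr (τ ω) t ω)
    (ρ q : ℝ → ℝ)
    (hfact : ∀ s t, 0 ≤ s → 0 ≤ t → R s t = ρ (min s t) * q (max s t))
    (hρcont : ContinuousOn ρ (Set.Ici 0)) (hqcont : ContinuousOn q (Set.Ici 0))
    (hρ0 : ρ 0 = 0)
    (hρpos : ∀ t, 0 < t → 0 < ρ t) (hqpos : ∀ t, 0 < t → 0 < q t)
    (hρq : MonotoneOn (fun t => ρ t / q t) (Set.Ioi 0))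
    (B : ℝ → ℝ → ℝ)
    (hB : ∀ s t, B s t = ρ (max s t) * q (min s t) - ρ (min s t) * q (max s t))
    (p : ℝ → ℝ → ℝ → ℝ)
    (hp : ∀ v x y, 0 < v →
      p v x y = (Real.sqrt (2 * Real.pi * v))⁻¹ * Real.exp (-(x - y)^2 / (2*v)))
    (A : ℝ → ℝ → ℝ) (hA : ∀ t s, A t s = R s s * R t t - R s t ^ 2)
    (φ : ℝ → ℝ → ℝ → ℝ) (hφ : ∀ t r x, 0 < t → t < r → φ t r x = p (A t r / R r r) x 0)
    (ϕ : ℝ → ℝ → ℝ → ℝ)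
    (hϕ : ∀ t r x, 0 < t → t < r →
      ϕ t r x = φ t r x / ∫ s in Set.Ioi t, φ t s x ∂(Measure.map τ P))
    (n : ℕ) (hn : 1 ≤ n) (t : ℕ → ℝ)
    (hmono : ∀ i j, 1 ≤ i → i < j → j ≤ n → t i < t j)
    (ht1 : 0 < t 1) (hFt1 : 0 < F (t 1))
    (c : ℕ → ℝ → ℝ)
    (hc1 : ∀ r, c 1 r = ρ r / (ρ (t 1) * B (t 1) r))
    (hck : ∀ k, 2 ≤ k → ∀ r, c k r = B (t (k-1)) r / (B (t k) r * B (t (k-1)) (t k)))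
    (ψ : ℕ → ℝ → ℝ → ℝ)
    (hψ : ∀ k, 1 ≤ k → k ≤ n - 1 → ∀ r x,
      ψ k r x = Real.sqrt (ρ r / B (t k) r) * Real.exp (-(1/2) * c k r * x^2) /
        ∫ s in Set.Ioc (t k) (t (k+1)),
          Real.sqrt (ρ s / B (t k) s) * Real.exp (-(1/2) * c k s * x^2) ∂(Measure.map τ P))
    (g : ℝ → ℝ) (hgmeas : Measurable g) (hgint : Integrable (fun ω => g (τ ω)) P) :
    P[(fun ω => g (τ ω))|⨆ k ∈ Finset.Icc 1 n,
        MeasurableSpace.comap (ξ (t k)) inferInstance] =ᵐ[P]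
      fun ω => (∫ r in Set.Ioc (0:ℝ) (t 1), g r ∂(Measure.map τ P)) / F (t 1) *
          (if ξ (t 1) ω = 0 then 1 else 0)
        + ∑ k ∈ Finset.Icc 1 (n - 1),
            (∫ r in Set.Ioc (t k) (t (k+1)), g r * ψ k r (ξ (t k) ω) ∂(Measure.map τ P)) *
              (if ξ (t k) ω ≠ 0 ∧ ξ (t (k+1)) ω = 0 then 1 else 0)
        + (∫ r in Set.Ioi (t n), g r * ϕ (t n) r (ξ (t n) ω) ∂(Measure.map τ P)) *
            (if ξ (t n) ω ≠ 0 then 1 else 0) := by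
  have hdet : ∀ s r, 0 < s → s < r → 0 < ρ r * q s - ρ s * q r := by
    intro s r hs hr
    have h1 := hRnd s r hs (hs.trans hr) hr.ne
    have hr0 := hs.trans hr
    rw [hfact s r hs.le hr0.le, hfact s s hs.le hs.le, hfact r r hr0.le hr0.le,
      min_eq_left hr.le, max_eq_right hr.le, min_self, max_self, min_self, max_self] at h1
    have h2 := hρpos s hs
    have h3 := hqpos r hr0
    have h4 : 0 < (ρ s * q r) * (ρ r * q s - ρ s * q r) := by linarith
    exact (mul_pos_iff_of_pos_left (mul_pos h2 h3)).1 h4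
  have hX : IsMarkovGaussian P X ρ q :=
    { measurable := hXmeas
      gaussian := isGaussianProcess_of_map_sum_eq_gaussianReal (fun s => hXmeas s)
        fun m ts c => hGauss m (fun i => ts i) (fun i => (ts i).2) c
      centered := fun s hs => by
        obtain ⟨v, hv⟩ := hGauss 1 (fun _ => s) (fun _ => hs) (fun _ => 1)
        have h1 := integral_map (μ := P) (φ := X s) (f := id) (hXmeas s).aemeasurable
          aestronglyMeasurable_id
        simp only [Finset.univ_unique, Finset.sum_const, Finset.card_singleton, one_mul,
          one_smul] at hv
        rw [hv] at h1
        simpa using h1.symm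
      cov := fun s r hs hr => by
        rw [← hR, hfact s r hs (hs.trans hr), min_eq_left hr, max_eq_right hr]
      continuousOn := hXcont
      continuousOn_left := hρcont
      continuousOn_right := hqcont
      left_pos := hρpos
      det_pos := hdet }
  have hB' : ∀ s r, s < r → B s r = ρ r * q s - ρ s * q r := fun s r hr => by
    rw [hB, max_eq_right hr.le, min_eq_left hr.le]
  have hξ' : ∀ s, 0 < s → ξ s = fun ω => bridgeAt X ρ s (τ ω) ω := fun s hs => by
    ext ω
    have h1 : 0 < max (τ ω) s := hs.trans_le (le_max_right _ _)
    rw [hξ, hξr, hfact _ _ hs.le h1.le, hfact _ _ h1.le h1.le, min_eq_left (le_max_right _ _),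
      max_eq_right (le_max_right _ _), min_self, max_self,
      mul_div_mul_right _ _ (hqpos _ h1).ne', bridgeAt]
  have htpos : ∀ k, 1 ≤ k → k ≤ n → 0 < t k := fun k h1 hk =>
    h1.eq_or_lt.elim (fun e => e ▸ ht1) fun e => ht1.trans (hmono 1 k le_rfl e hk)
  have hFP : F (t 1) = P.real (τ ⁻¹' Iic (t 1)) := hF (t 1)
  have hσ : (⨆ k ∈ Finset.Icc 1 n, MeasurableSpace.comap (ξ (t k)) inferInstance) =
      ⨆ k ∈ Finset.Icc 1 n, MeasurableSpace.comap
        ((fun k ω => bridgeAt X ρ (t k) (τ ω) ω) k) (inferInstance : MeasurableSpace ℝ) :=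
    iSup_congr fun k => iSup_congr fun hk => by
      rw [hξ' _ (htpos k (Finset.mem_Icc.1 hk).1 (Finset.mem_Icc.1 hk).2)]
  have hlast : ∀ z, ∫ r in Ioi (t n), g r * ϕ (t n) r z ∂(P.map τ) =
      posteriorMean (P.map τ) ρ q (Ioi (t n)) (t n) g z := fun z => by
    have htn := htpos n hn le_rfl
    rw [← posteriorMean_eq_setIntegral measurableSet_Ioi one_ne_zero
      (w := fun r => φ (t n) r z) (fun r hr => ?_) g]
    · exact setIntegral_congr_fun measurableSet_Ioi fun r hr => by simp only [hϕ _ _ z htn hr]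
    · have hr0 := htn.trans hr
      have h1 := hX.coe_bridgeVar_pos htn hr
      have h2 : A (t n) r / R r r = bridgeVar ρ q (t n) r := by
        have h3 := hρpos r hr0
        have h4 := hqpos r hr0
        rw [hX.coe_bridgeVar htn hr, hA, hfact r r hr0.le hr0.le, hfact _ _ hr0.le htn.le,
          hfact _ _ htn.le htn.le, min_self, max_self, min_self, max_self,
          min_eq_right (le_of_lt hr), max_eq_left (le_of_lt hr)]
        field_simp
      rw [hφ _ _ _ htn hr, h2, hp _ _ _ h1, gaussianPDFReal, one_mul]
  have hmid : ∀ k ∈ Finset.Icc 1 (n - 1), ∀ z,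
      ∫ r in Ioc (t k) (t (k + 1)), g r * ψ k r z ∂(P.map τ) =
        posteriorMean (P.map τ) ρ q (Ioc (t k) (t (k + 1))) (t k) g z := fun k hk z => by
    obtain ⟨hk1, hkn⟩ := Finset.mem_Icc.1 hk
    have htk := htpos k hk1 (by omega)
    obtain ⟨κ, hκ⟩ : ∃ κ, ∀ r, t k < r →
        c k r = ρ r / (ρ (t k) * (ρ r * q (t k) - ρ (t k) * q r)) - κ := by
      rcases hk1.eq_or_lt with rfl | hk2
      · exact ⟨0, fun r hr => by rw [hc1, hB' _ _ hr, sub_zero]⟩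
      · have htk' := htpos (k - 1) (by omega) (by omega)
        have hlt := hmono (k - 1) k (by omega) (by omega) (by omega)
        refine ⟨-ρ (t (k - 1)) / (ρ (t k) * (ρ (t k) * q (t (k - 1)) - ρ (t (k - 1)) * q (t k))),
          fun r hr => ?_⟩
        rw [hck k hk2, hB' _ _ hr, hB' _ _ hlt, hB' _ _ (hlt.trans hr)]
        have h1 := (hdet _ _ htk' hlt).ne'
        have h2 := (hdet _ _ htk hr).ne'
        have h3 := (hρpos _ htk).ne'
        rw [div_sub_div _ _ (mul_ne_zero h3 h2) (mul_ne_zero h3 h1), div_eq_div_iff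
          (mul_ne_zero h2 h1) (mul_ne_zero (mul_ne_zero h3 h2) (mul_ne_zero h3 h1))]
        ring
    rw [← posteriorMean_eq_setIntegral measurableSet_Ioc
      (K := √(2 * π * ρ (t k)) * rexp (κ * z ^ 2 / 2)) ?_
      (w := fun r => √(ρ r / B (t k) r) * rexp (-(1 / 2) * c k r * z ^ 2)) (fun r hr => ?_) g]
    · simp only [hψ k hk1 hkn]
    · have := hρpos _ htk
      positivity
    · simp only [hB' _ _ hr.1]
      exact hX.sqrt_mul_exp_eq_mul_gaussianPDFReal htk hr.1 (hκ r hr.1) z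
  refine (hX.condExp_length hτmeas hτpos hindep hn hmono ht1 (hFP ▸ hFt1.ne') hgmeas hgint
    (fun k => rfl) hσ).trans (.of_forall fun ω => ?_)
  simp only
  rw [hlast, ← hFP, hξ' _ ht1, hξ' _ (htpos n hn le_rfl)]
  congr 2
  refine Finset.sum_congr rfl fun k hk => ?_
  have hk' := Finset.mem_Icc.1 hk
  rw [hmid k hk, hξ' _ (htpos k hk'.1 (by omega)), hξ' _ (htpos (k + 1) (by omega) (by omega))]
end

section
/- Let n ≥ 1 and 0 < t_1 < … < t_n < u, and let g : ℝ → ℝ be bounded measurable. Then ℙ-a.s., E[g(ξ_u) | σ(ξ_{t_1}, ξ_{t_2}, …, ξ_{t_n})] = E[g(ξ_u) | σ(ξ_{t_n})]. -/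
open MeasureTheory ProbabilityTheory Real Set

/-- If `f` and `g` are independent and the pair `(f, g)` is independent of `h`, then `f` is
independent of the pair `(g, h)`. -/
lemma IndepFun.prodMk_right_of_prodMk_left {Ω α β γ : Type*} [MeasurableSpace Ω]
    [MeasurableSpace α] [MeasurableSpace β] [MeasurableSpace γ]
    {P : Measure Ω} [IsProbabilityMeasure P] {f : Ω → α} {g : Ω → β} {h : Ω → γ}
    (hf : Measurable f) (hg : Measurable g) (hh : Measurable h)
    (hfg : IndepFun f g P) (hfgh : IndepFun (fun ω => (f ω, g ω)) h P) :
    IndepFun f (fun ω => (g ω, h ω)) P := by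
  have := Measure.isProbabilityMeasure_map (μ := P) hf.aemeasurable
  have := Measure.isProbabilityMeasure_map (μ := P) hg.aemeasurable
  have := Measure.isProbabilityMeasure_map (μ := P) hh.aemeasurable
  have hgh : IndepFun g h P := hfgh.comp measurable_snd measurable_id
  rw [indepFun_iff_map_prod_eq_prod_map_map hf.aemeasurable (hg.prodMk hh).aemeasurable,
    hgh.map_prod_eq_prod_map_map hg.aemeasurable hh.aemeasurable, ← Measure.prodAssoc_prod,
    ← hfg.map_prod_eq_prod_map_map hf.aemeasurable hg.aemeasurable,
    ← hfgh.map_prod_eq_prod_map_map (hf.prodMk hg).aemeasurable hh.aemeasurable,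
    Measure.map_map MeasurableEquiv.prodAssoc.measurable ((hf.prodMk hg).prodMk hh)]
  rfl

/-- If `m₁` and `m₂` are independent and `m₁ ⊔ m₂` is independent of `m₃`, then `m₁` is
independent of `m₂ ⊔ m₃`. -/
lemma Indep.sup_right_of_sup_left {Ω : Type*} [mΩ : MeasurableSpace Ω]
    {P : Measure Ω} [IsProbabilityMeasure P] {m₁ m₂ m₃ : MeasurableSpace Ω}
    (h₁ : m₁ ≤ mΩ) (h₂ : m₂ ≤ mΩ) (h₃ : m₃ ≤ mΩ)
    (h₁₂ : Indep m₁ m₂ P) (h : Indep (m₁ ⊔ m₂) m₃ P) : Indep m₁ (m₂ ⊔ m₃) P := by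
  have hprod (m m' : MeasurableSpace Ω) :
      MeasurableSpace.comap (fun ω : Ω => (ω, ω)) (m.prod m') = m ⊔ m' := by
    simp [MeasurableSpace.prod, MeasurableSpace.comap_sup, MeasurableSpace.comap_comp,
      Function.comp_def]
    simp [← Function.id_def]
  have key := @IndepFun.prodMk_right_of_prodMk_left Ω Ω Ω Ω mΩ m₁ m₂ m₃ P _ id id id
    (measurable_id'' h₁) (measurable_id'' h₂) (measurable_id'' h₃)
  simp only [IndepFun_iff_Indep, id_eq, MeasurableSpace.comap_id] at key
  rw [← hprod m₂ m₃]
  exact key h₁₂ (by rw [← hprod m₁ m₂] at h; exact h)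

/-- An event depending on two independent variables is null as soon as all its sections
are null. -/
lemma IndepFun.measure_preimage_prodMk_eq_zero {Ω α β : Type*} [MeasurableSpace Ω]
    [MeasurableSpace α] [MeasurableSpace β]
    {P : Measure Ω} [IsProbabilityMeasure P] {f : Ω → α} {g : Ω → β}
    (hf : Measurable f) (hg : Measurable g) (hfg : IndepFun f g P)
    {S : Set (α × β)} (hS : MeasurableSet S) (h : ∀ a, P {ω | (a, g ω) ∈ S} = 0) :
    P {ω | (f ω, g ω) ∈ S} = 0 := by
  have := Measure.isProbabilityMeasure_map (μ := P) hf.aemeasurable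
  have := Measure.isProbabilityMeasure_map (μ := P) hg.aemeasurable
  have h1 : P {ω | (f ω, g ω) ∈ S} = P.map (fun ω => (f ω, g ω)) S := by
    rw [Measure.map_apply (hf.prodMk hg) hS]; rfl
  rw [h1, hfg.map_prod_eq_prod_map_map hf.aemeasurable hg.aemeasurable, Measure.prod_apply hS]
  have h2 (a : α) : P.map g (Prod.mk a ⁻¹' S) = 0 := by
    rw [Measure.map_apply hg (measurable_prodMk_left hS)]; exact h a
  simp [h2]

/-- If `f` integrates to zero over every event of `σ(W)` and `Z` is independent of `(W, f)`,
then `f` integrates to zero over every event of `σ(Z, W)`. -/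
lemma setIntegral_preimage_prodMk_eq_zero {Ω α β : Type*} [MeasurableSpace Ω]
    [MeasurableSpace α] [MeasurableSpace β]
    {P : Measure Ω} [IsProbabilityMeasure P] {Z : Ω → α} {W : Ω → β} {f : Ω → ℝ}
    (hZ : Measurable Z) (hW : Measurable W) (hf : Measurable f) (hfi : Integrable f P)
    (hind : IndepFun Z (fun ω => (W ω, f ω)) P)
    (h : ∀ B, MeasurableSet B → ∫ ω in W ⁻¹' B, f ω ∂P = 0)
    {D : Set (α × β)} (hD : MeasurableSet D) :
    ∫ ω in (fun ω => (Z ω, W ω)) ⁻¹' D, f ω ∂P = 0 := by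
  have := Measure.isProbabilityMeasure_map (μ := P) hZ.aemeasurable
  have := Measure.isProbabilityMeasure_map (μ := P) (hW.prodMk hf).aemeasurable
  let k : α × (β × ℝ) → ℝ := ((fun p => (p.1, p.2.1)) ⁻¹' D).indicator (fun p => p.2.2)
  have hDm : MeasurableSet ((fun p : α × (β × ℝ) => (p.1, p.2.1)) ⁻¹' D) :=
    (by fun_prop : Measurable fun p : α × (β × ℝ) => (p.1, p.2.1)) hD
  have hk : Measurable k := Measurable.indicator (by fun_prop) hDm
  have hT : Measurable (fun ω => (Z ω, (W ω, f ω))) := by fun_prop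
  have hkT : (fun ω => k (Z ω, (W ω, f ω))) =
      ((fun ω => (Z ω, W ω)) ⁻¹' D).indicator f := by
    rfl
  have hmap := hind.map_prod_eq_prod_map_map hZ.aemeasurable (hW.prodMk hf).aemeasurable
  have hki : Integrable k ((P.map Z).prod (P.map fun ω => (W ω, f ω))) := by
    rw [← hmap, integrable_map_measure hk.aestronglyMeasurable hT.aemeasurable]
    exact (congrArg (Integrable · P) hkT).mpr (hfi.indicator ((hZ.prodMk hW) hD))
  rw [← integral_indicator ((hZ.prodMk hW) hD), ← hkT,
    ← integral_map (f := k) hT.aemeasurable hk.aestronglyMeasurable, hmap, integral_prod _ hki]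
  refine integral_eq_zero_of_ae (ae_of_all _ fun z => ?_)
  dsimp only [Pi.zero_apply]
  rw [integral_map (f := fun y => k (z, y)) (hW.prodMk hf).aemeasurable
    (hk.comp measurable_prodMk_left).aestronglyMeasurable,
    ← h _ (measurable_prodMk_left (x := z) hD),
    ← integral_indicator (hW (measurable_prodMk_left hD))]
  rfl

/-- If `W = 0` forces `U = 0`, while on `{W ≠ 0}` the vector `V` is a linear perturbation in `W`
of a vector independent of `(W, U)`, where `W` is a coordinate of `V`, then conditioning a
function of `U` on `V` amounts to conditioning it on `W`. -/
lemma condExp_comap_eq_condExp_comap_eval {Ω ι : Type*} {m mΩ : MeasurableSpace Ω}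
    {P : Measure Ω} [IsProbabilityMeasure P] {V Z : Ω → ι → ℝ} {U : Ω → ℝ}
    (hm : m ≤ mΩ) (hV : Measurable V) (hZ : Measurable Z) (i₀ : ι) (c : ι → ℝ)
    (hWm : Measurable[m] fun ω => V ω i₀) (hUm : Measurable[m] U)
    (hind : Indep (MeasurableSpace.comap Z inferInstance) m P)
    (hne : ∀ᵐ ω ∂P, V ω i₀ ≠ 0 → V ω = Z ω + V ω i₀ • c)
    (hzero : ∀ᵐ ω ∂P, V ω i₀ = 0 → U ω = 0)
    {g : ℝ → ℝ} (hg : Measurable g) {C : ℝ} (hC : ∀ x, |g x| ≤ C) :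
    P[fun ω => g (U ω)|MeasurableSpace.comap V inferInstance] =ᵐ[P]
      P[fun ω => g (U ω)|MeasurableSpace.comap (fun ω => V ω i₀) inferInstance] := by
  have hW : Measurable fun ω => V ω i₀ := hWm.mono hm le_rfl
  have hcW : MeasurableSpace.comap (fun ω => V ω i₀) inferInstance ≤ mΩ := hW.comap_le
  have hcV : MeasurableSpace.comap V inferInstance ≤ mΩ := hV.comap_le
  have hWV : MeasurableSpace.comap (fun ω => V ω i₀) inferInstance ≤
      MeasurableSpace.comap V inferInstance :=
    Measurable.comap_le ((measurable_pi_apply i₀).comp (comap_measurable V))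
  set Y := P[fun ω => g (U ω)|MeasurableSpace.comap (fun ω => V ω i₀) inferInstance] with hY
  have hYm : StronglyMeasurable[MeasurableSpace.comap (fun ω => V ω i₀) inferInstance] Y :=
    stronglyMeasurable_condExp
  have hgU : Integrable (fun ω => g (U ω)) P :=
    Integrable.of_bound (hg.comp (hUm.mono hm le_rfl)).aestronglyMeasurable C
      (ae_of_all _ fun ω => hC _)
  have hYi : Integrable Y P := integrable_condExp
  have hfm : Measurable[m] (fun ω => g (U ω) - Y ω) :=
    (hg.comp hUm).sub (hYm.measurable.mono hWm.comap_le le_rfl)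
  have hA : MeasurableSet[MeasurableSpace.comap (fun ω => V ω i₀) inferInstance]
      ((fun ω => V ω i₀) ⁻¹' {0}) := ⟨{0}, measurableSet_singleton 0, rfl⟩
  have hYA : ∀ᵐ ω ∂P, V ω i₀ = 0 → g (U ω) - Y ω = 0 := by
    have h1 := condExp_indicator hgU hA
    have h2 : ((fun ω => V ω i₀) ⁻¹' {0}).indicator (fun ω => g (U ω)) =ᵐ[P]
        ((fun ω => V ω i₀) ⁻¹' {0}).indicator (fun _ => g 0) := by
      filter_upwards [hzero] with ω hω
      by_cases h : V ω i₀ = 0 <;> simp [indicator, h, hω]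
    have h3 := condExp_congr_ae (m := MeasurableSpace.comap (fun ω => V ω i₀) inferInstance) h2
    rw [condExp_of_stronglyMeasurable hcW (stronglyMeasurable_const.indicator hA)
      ((integrable_const _).indicator (hcW _ hA))] at h3
    filter_upwards [h1, h3, hzero] with ω h1 h3 h0 hω
    rw [h1] at h3
    simp only [indicator, mem_preimage, hω, mem_singleton_iff, if_true] at h3
    rw [h0 hω, hY, h3, sub_self]
  refine (ae_eq_condExp_of_forall_setIntegral_eq hcV hgU (fun _ _ _ => hYi.integrableOn) ?_
    (hYm.mono hWV).aestronglyMeasurable).symm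
  rintro _ ⟨D, hD, rfl⟩ -
  rw [eq_comm, ← sub_eq_zero, ← integral_sub hgU.integrableOn hYi.integrableOn,
    ← integral_inter_add_sdiff (f := fun ω => g (U ω) - Y ω) (hcW _ hA)
      (hgU.sub hYi).integrableOn]
  have hfirst : ∫ ω in V ⁻¹' D ∩ (fun ω => V ω i₀) ⁻¹' {0}, (g (U ω) - Y ω) ∂P = 0 := by
    refine setIntegral_eq_zero_of_ae_eq_zero ?_
    filter_upwards [hYA] with ω hω h using hω h.2
  have hsecond : ∫ ω in V ⁻¹' D \ (fun ω => V ω i₀) ⁻¹' {0}, (g (U ω) - Y ω) ∂P = 0 := by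
    have hset : (V ⁻¹' D \ (fun ω => V ω i₀) ⁻¹' {0} : Set Ω) =ᵐ[P]
        (fun ω => (Z ω, V ω i₀)) ⁻¹' {p | p.2 ≠ 0 ∧ p.1 + p.2 • c ∈ D} := by
      filter_upwards [hne] with ω hω
      refine propext ?_
      change (V ω ∈ D ∧ ¬ V ω i₀ = 0) ↔ (V ω i₀ ≠ 0 ∧ Z ω + V ω i₀ • c ∈ D)
      by_cases h : V ω i₀ = 0
      · simp [h]
      · simp only [← hω h]; tauto
    rw [setIntegral_congr_set hset]
    refine setIntegral_preimage_prodMk_eq_zero hZ hW (hfm.mono hm le_rfl) (hgU.sub hYi) ?_ ?_ ?_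
    · rw [IndepFun_iff_Indep]
      exact indep_of_indep_of_le_right hind (hWm.prodMk hfm).comap_le
    · intro B hB
      rw [integral_sub hgU.integrableOn hYi.integrableOn, hY,
        setIntegral_condExp hcW hgU ⟨B, hB, rfl⟩, sub_self]
    · refine (measurable_snd (measurableSet_singleton 0).compl).inter ?_
      have : Measurable fun p : (ι → ℝ) × ℝ => p.1 + p.2 • c :=
        measurable_pi_iff.2 fun i => by simp only [Pi.add_apply, Pi.smul_apply]; fun_prop
      exact this hD
  rw [hfirst, hsecond, add_zero]

/-- A process all of whose finite linear combinations are centered Gaussian is a Gaussian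
process. -/
lemma isGaussianProcess_of_forall_map_sum {Ω T : Type*} [MeasurableSpace Ω] {P : Measure Ω}
    {Y : T → Ω → ℝ} (hY : ∀ s, Measurable (Y s))
    (h : ∀ (m : ℕ) (s : Fin m → T) (c : Fin m → ℝ),
      ∃ v : NNReal, P.map (fun ω => ∑ i, c i * Y (s i) ω) = gaussianReal 0 v) :
    IsGaussianProcess Y P where
  hasGaussianLaw I := by
    refine ⟨⟨fun L => ?_⟩⟩
    classical
    have hmeas : Measurable fun ω => I.restrict (Y · ω) :=
      measurable_pi_iff.2 fun i => hY i
    obtain ⟨v, hv⟩ := h I.card (fun i => (I.equivFin.symm i : T))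
      (fun i => L (Pi.single (I.equivFin.symm i) 1))
    have hL : ∀ x : I → ℝ, L x = ∑ i, L (Pi.single (I.equivFin.symm i) 1) *
        x (I.equivFin.symm i) := by
      intro x
      rw [Equiv.sum_comp I.equivFin.symm (fun i => L (Pi.single i 1) * x i)]
      conv_lhs => rw [pi_eq_sum_univ' x, map_sum]
      refine Finset.sum_congr rfl fun i _ => ?_
      rw [map_smul, smul_eq_mul, mul_comm]
    have hmap : (P.map fun ω => I.restrict (Y · ω)).map L = gaussianReal 0 v := by
      rw [Measure.map_map (by fun_prop) hmeas, ← hv]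
      congr 1
      ext ω
      exact hL _
    have hmean : (P.map fun ω => I.restrict (Y · ω))[L] = 0 := by
      have := integral_map (μ := P.map fun ω => I.restrict (Y · ω)) (φ := L)
        (by fun_prop) (f := id) (by fun_prop)
      rw [hmap] at this
      simpa using this.symm
    have hvar : Var[L; P.map fun ω => I.restrict (Y · ω)] = v := by
      have := variance_map (μ := P.map fun ω => I.restrict (Y · ω)) (Y := L) (X := id)
        (by fun_prop) (by fun_prop)
      rw [hmap, variance_id_gaussianReal] at this
      simpa using this.symm
    rw [hmap, hmean, hvar, Real.toNNReal_coe]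

/-- A process with paths continuous on `[0, ∞)`, sampled at the random time `τ ∨ s`, is measurable
with respect to any σ-algebra that makes `τ` and the process after time `s` measurable. -/
lemma measurable_uncurry_max {Ω : Type*} [MeasurableSpace Ω] {X : ℝ → Ω → ℝ}
    (hc : ∀ ω, ContinuousOn (fun t => X t ω) (Ici 0)) {s : ℝ} (hs : 0 ≤ s)
    (hX : ∀ r, s ≤ r → Measurable (X r)) :
    Measurable fun p : ℝ × Ω => X (max p.1 s) p.2 :=
  measurable_uncurry_of_continuous_of_measurable (u := fun r ω => X (max r s) ω)
    (fun ω => (hc ω).comp_continuous (by fun_prop) fun _ => hs.trans (le_max_right _ _))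
    fun _ => hX _ (le_max_right _ _)

/-- The σ-algebra generated by the values of a process after time `a`. -/
abbrev sigmaAfter {Ω : Type*} (X : ℝ → Ω → ℝ) (a : ℝ) : MeasurableSpace Ω :=
  ⨆ s ∈ Ici a, MeasurableSpace.comap (X s) inferInstance

lemma measurable_sigmaAfter {Ω : Type*} (X : ℝ → Ω → ℝ) {a s : ℝ} (h : a ≤ s) :
    Measurable[sigmaAfter X a] (X s) :=
  Measurable.of_comap_le (le_iSup₂_of_le s h le_rfl)

lemma sigmaAfter_antitone {Ω : Type*} (X : ℝ → Ω → ℝ) : Antitone (sigmaAfter X) :=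
  fun _ _ hab => biSup_mono fun _ hs => hab.trans hs

/-- If `Y₁ - a Y₂` is centered Gaussian and the strict Cauchy-Schwarz inequality holds for
`Y₁` and `Y₂`, then `Y₁ - a Y₂` almost surely does not vanish. -/
lemma measure_sub_mul_eq_zero {Ω : Type*} [MeasurableSpace Ω] {P : Measure Ω}
    {Y₁ Y₂ : Ω → ℝ} (h₁ : Measurable Y₁) (h₂ : Measurable Y₂) {a : ℝ} {v : NNReal}
    (hv : P.map (fun ω => Y₁ ω - a * Y₂ ω) = gaussianReal 0 v)
    (hCS : (∫ ω, Y₁ ω * Y₂ ω ∂P) ^ 2 < (∫ ω, Y₁ ω * Y₁ ω ∂P) * ∫ ω, Y₂ ω * Y₂ ω ∂P) :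
    P {ω | Y₁ ω - a * Y₂ ω = 0} = 0 := by
  have hmeas : Measurable fun ω => Y₁ ω - a * Y₂ ω := h₁.sub (h₂.const_mul a)
  have hv0 : v ≠ 0 := by
    rintro rfl
    rw [gaussianReal_zero_var] at hv
    have hae : ∀ᵐ ω ∂P, Y₁ ω = a * Y₂ ω := by
      have : ∀ᵐ x ∂(P.map fun ω => Y₁ ω - a * Y₂ ω), x = 0 := by
        rw [hv, ae_dirac_eq]; simp
      filter_upwards [ae_of_ae_map hmeas.aemeasurable this] with ω hω using sub_eq_zero.1 hω
    have h12 : ∫ ω, Y₁ ω * Y₂ ω ∂P = a * ∫ ω, Y₂ ω * Y₂ ω ∂P := by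
      rw [← integral_const_mul]
      refine integral_congr_ae ?_
      filter_upwards [hae] with ω hω
      rw [hω]; ring
    have h11 : ∫ ω, Y₁ ω * Y₁ ω ∂P = a ^ 2 * ∫ ω, Y₂ ω * Y₂ ω ∂P := by
      rw [← integral_const_mul]
      refine integral_congr_ae ?_
      filter_upwards [hae] with ω hω
      rw [hω]; ring
    rw [h12, h11] at hCS
    nlinarith
  have := nullSingletonClass_gaussianReal (μ := 0) hv0
  have h0 : P.map (fun ω => Y₁ ω - a * Y₂ ω) {0} = 0 := by rw [hv]; exact measure_singleton 0
  rwa [Measure.map_apply hmeas (measurableSet_singleton 0)] at h0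

/-- For a Gaussian process with covariance `ρ (min s t) * q (max s t)`, the backward residuals
`X (t k) - ρ (t k) / ρ T * X T` with `t k ≤ T` are independent of the process after time `T`. -/
lemma indep_residual_sigmaAfter {Ω ι : Type*} [MeasurableSpace Ω] {P : Measure Ω}
    [IsProbabilityMeasure P] {X : ℝ → Ω → ℝ} (hX : ∀ s, Measurable (X s))
    (hGP : IsGaussianProcess (fun (s : Ici (0 : ℝ)) ω => X s ω) P) {ρ q : ℝ → ℝ}
    (hcov : ∀ a b, 0 ≤ a → 0 ≤ b → cov[X a, X b; P] = ρ (min a b) * q (max a b))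
    {T : ℝ} (hT : 0 ≤ T) (hρT : ρ T ≠ 0) {t : ι → ℝ} (ht : ∀ k, 0 ≤ t k) (htT : ∀ k, t k ≤ T) :
    Indep (MeasurableSpace.comap (fun ω k => X (t k) ω - ρ (t k) / ρ T * X T ω) inferInstance)
      (sigmaAfter X T) P := by
  have hL2 : ∀ s, 0 ≤ s → MemLp (X s) 2 P := fun s hs =>
    (hGP.hasGaussianLaw_eval ⟨s, hs⟩).memLp_two
  have hsum : IsGaussianProcess (Sum.elim (fun (k : ι) ω => X (t k) ω - ρ (t k) / ρ T * X T ω)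
      fun (s : Ici T) ω => X s ω) P := by
    classical
    refine hGP.of_isGaussianProcess ?_
    rintro (k | s)
    · refine ⟨{⟨t k, ht k⟩, ⟨T, hT⟩},
        ContinuousLinearMap.proj ⟨⟨t k, ht k⟩, by simp⟩ -
          (ρ (t k) / ρ T) • ContinuousLinearMap.proj ⟨⟨T, hT⟩, by simp⟩, fun ω => ?_⟩
      simp
    · exact ⟨{⟨s, hT.trans s.2⟩}, ContinuousLinearMap.proj ⟨⟨s, hT.trans s.2⟩, by simp⟩,
        fun ω => by simp⟩
  have hind : IndepFun (fun ω k => X (t k) ω - ρ (t k) / ρ T * X T ω)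
      (fun ω (s : Ici T) => X s ω) P := by
    refine hsum.indepFun_of_covariance_eq_zero
      (fun k => ((hX _).sub ((hX _).const_mul _)).aemeasurable) (fun s => (hX s).aemeasurable) ?_
    intro k s
    have hs : 0 ≤ (s : ℝ) := hT.trans s.2
    change cov[X (t k) - (ρ (t k) / ρ T) • X T, X s; P] = 0
    rw [covariance_sub_left (hL2 _ (ht k)) ((hL2 _ hT).const_smul _) (hL2 _ hs),
      covariance_smul_left, hcov _ _ (ht k) hs, hcov _ _ hT hs, min_eq_left ((htT k).trans s.2),
      max_eq_right ((htT k).trans s.2), min_eq_left s.2, max_eq_right s.2, ← mul_assoc,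
      div_mul_cancel₀ _ hρT, sub_self]
  refine indep_of_indep_of_le_right ((IndepFun_iff_Indep _ _ _).1 hind) (iSup₂_le fun s hs => ?_)
  exact Measurable.comap_le ((measurable_pi_apply (⟨s, hs⟩ : Ici T)).comp
    (comap_measurable fun ω (s : Ici T) => X s ω))

/-- Markov-type reduction: E[g(ξ_u) | σ(ξ_{t_1}, …, ξ_{t_n})] = E[g(ξ_u) | σ(ξ_{t_n})]
a.s., for 0 < t_1 < … < t_n < u and g bounded measurable. -/
theorem stmt_14
    {Ω : Type*} [MeasurableSpace Ω] (P : Measure Ω) [IsProbabilityMeasure P]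
    (X : ℝ → Ω → ℝ)
    (hXmeas : ∀ t, Measurable (X t))
    (hGauss : ∀ (m : ℕ) (ts : Fin m → ℝ), (∀ i, 0 ≤ ts i) → ∀ c : Fin m → ℝ,
      ∃ v : NNReal, Measure.map (fun ω => ∑ i, c i * X (ts i) ω) P = gaussianReal 0 v)
    (hXcont : ∀ ω, ContinuousOn (fun t => X t ω) (Set.Ici 0))
    (hX0 : ∀ᵐ ω ∂P, X 0 ω = 0)
    (R : ℝ → ℝ → ℝ)
    (hR : ∀ s t, R s t = ∫ ω, X s ω * X t ω ∂P)
    (hRpos : ∀ t, 0 < t → 0 < R t t)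
    (hRnd : ∀ s t, 0 < s → 0 < t → s ≠ t → (R s t)^2 < R s s * R t t)
    (ξr : ℝ → ℝ → Ω → ℝ)
    (hξr : ∀ r t ω, ξr r t ω = X t ω - R t (max r t) / R (max r t) (max r t) * X (max r t) ω)
    (τ : Ω → ℝ) (hτmeas : Measurable τ) (hτpos : ∀ ω, 0 < τ ω)
    (hindep : Indep (MeasurableSpace.comap τ inferInstance)
      (⨆ t ∈ Set.Ici (0:ℝ), MeasurableSpace.comap (X t) inferInstance) P)
    (F : ℝ → ℝ) (hF : ∀ t, F t = (P {ω | τ ω ≤ t}).toReal)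
    (ξ : ℝ → Ω → ℝ) (hξ : ∀ t ω, ξ t ω = ξr (τ ω) t ω)
    (ρ q : ℝ → ℝ)
    (hfact : ∀ s t, 0 ≤ s → 0 ≤ t → R s t = ρ (min s t) * q (max s t))
    (hρcont : ContinuousOn ρ (Set.Ici 0)) (hqcont : ContinuousOn q (Set.Ici 0))
    (hρ0 : ρ 0 = 0)
    (hρpos : ∀ t, 0 < t → 0 < ρ t) (hqpos : ∀ t, 0 < t → 0 < q t)
    (hρq : MonotoneOn (fun t => ρ t / q t) (Set.Ioi 0))
    (n : ℕ) (hn : 1 ≤ n) (t : ℕ → ℝ)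
    (hmono : ∀ i j, 1 ≤ i → i < j → j ≤ n → t i < t j)
    (ht1 : 0 < t 1) (u : ℝ) (htnu : t n < u)
    (g : ℝ → ℝ) (hgmeas : Measurable g) (C : ℝ) (hgbdd : ∀ x, |g x| ≤ C) :
    P[(fun ω => g (ξ u ω))|⨆ k ∈ Finset.Icc 1 n,
        MeasurableSpace.comap (ξ (t k)) inferInstance] =ᵐ[P]
    P[(fun ω => g (ξ u ω))|MeasurableSpace.comap (ξ (t n)) inferInstance] := by
  have htpos : ∀ k, 1 ≤ k → k ≤ n → 0 < t k := by
    intro k hk hkn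
    rcases hk.eq_or_lt with rfl | h
    · exact ht1
    · exact ht1.trans (hmono 1 k le_rfl h hkn)
  have htle : ∀ k, k ≤ n → 1 ≤ k → t k ≤ t n := by
    intro k hkn hk
    rcases hkn.eq_or_lt with rfl | h
    · exact le_rfl
    · exact (hmono k n hk h le_rfl).le
  have hT : 0 < t n := htpos n hn le_rfl
  have hGP : IsGaussianProcess (fun (s : Ici (0 : ℝ)) ω => X s ω) P :=
    isGaussianProcess_of_forall_map_sum (fun s => hXmeas s)
      fun m s c => hGauss m (fun i => s i) (fun i => (s i).2) c
  have hmean : ∀ s, 0 ≤ s → P[X s] = 0 := by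
    intro s hs
    obtain ⟨v, hv⟩ := hGauss 1 (fun _ => s) (fun _ => hs) (fun _ => 1)
    simp only [Finset.univ_unique, Finset.sum_const, Finset.card_singleton, one_smul,
      one_mul] at hv
    have := integral_map (μ := P) (hXmeas s).aemeasurable (f := id) (by fun_prop)
    change Measure.map (X s) P = _ at hv
    rw [hv] at this
    simpa using this.symm
  have hcov : ∀ a b, 0 ≤ a → 0 ≤ b → cov[X a, X b; P] = R a b := by
    intro a b ha hb
    rw [covariance_eq_sub (hGP.hasGaussianLaw_eval ⟨a, ha⟩).memLp_two
      (hGP.hasGaussianLaw_eval ⟨b, hb⟩).memLp_two, hmean a ha, hR]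
    simp
  let ι := {k // k ∈ Finset.Icc 1 n}
  have hι : ∀ k : ι, 0 < t k ∧ t k ≤ t n := fun k => by
    have := Finset.mem_Icc.1 k.2
    exact ⟨htpos k this.1 this.2, htle k this.2 this.1⟩
  let i₀ : ι := ⟨n, Finset.mem_Icc.2 ⟨hn, le_rfl⟩⟩
  let c : ι → ℝ := fun k => ρ (t k) / ρ (t n)
  let Z : Ω → ι → ℝ := fun ω k => X (t k) ω - c k * X (t n) ω
  have hZm : ∀ m : MeasurableSpace Ω, (∀ s, 0 ≤ s → Measurable[m] (X s)) → Measurable[m] Z :=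
    fun m hX => measurable_pi_iff.2 fun k =>
      (hX (t k) (hι k).1.le).sub ((hX (t n) hT.le).const_mul (c k))
  have hZ : Measurable Z := hZm _ fun s _ => hXmeas s
  have hmX : sigmaAfter X 0 ≤ ‹MeasurableSpace Ω› := iSup₂_le fun s _ => (hXmeas s).comap_le
  have hVmX : sigmaAfter X (t n) ≤ sigmaAfter X 0 := sigmaAfter_antitone X hT.le
  have hZmX : MeasurableSpace.comap Z inferInstance ≤ sigmaAfter X 0 :=
    (hZm _ fun _ => measurable_sigmaAfter X).comap_le
  have hle : sigmaAfter X (t n) ⊔ MeasurableSpace.comap τ inferInstance ≤ ‹MeasurableSpace Ω› :=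
    sup_le (hVmX.trans hmX) hτmeas.comap_le
  have hind : Indep (MeasurableSpace.comap Z inferInstance)
      (sigmaAfter X (t n) ⊔ MeasurableSpace.comap τ inferInstance) P :=
    Indep.sup_right_of_sup_left hZ.comap_le (hVmX.trans hmX) hτmeas.comap_le
      (indep_residual_sigmaAfter hXmeas hGP
        (fun a b ha hb => (hcov a b ha hb).trans (hfact a b ha hb)) hT.le (hρpos _ hT).ne'
        (fun k => (hι k).1.le) fun k => (hι k).2)
      (indep_of_indep_of_le_left hindep.symm (sup_le hZmX hVmX))
  have hratio : ∀ s, 0 ≤ s → Measurable fun r => R s (max r s) / R (max r s) (max r s) := by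
    intro s hs
    have h0 : ∀ r, 0 ≤ max r s := fun r => hs.trans (le_max_right _ _)
    have hq : Measurable fun r => q (max r s) :=
      (hqcont.comp_continuous (by fun_prop) h0).measurable
    have hρ : Measurable fun r => ρ (max r s) :=
      (hρcont.comp_continuous (by fun_prop) h0).measurable
    have : (fun r => R s (max r s) / R (max r s) (max r s)) =
        fun r => ρ s * q (max r s) / (ρ (max r s) * q (max r s)) := by
      ext r
      rw [hfact _ _ hs (h0 r), hfact _ _ (h0 r) (h0 r)]
      simp
    rw [this]
    exact (hq.const_mul _).div (hρ.mul hq)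
  have hbridge : ∀ (m : MeasurableSpace Ω) (s : ℝ), 0 ≤ s → (∀ r, s ≤ r → Measurable[m] (X r)) →
      Measurable fun p : ℝ × Ω => ξr p.1 s p.2 := by
    intro m s hs hX
    simp only [hξr]
    exact ((hX s le_rfl).comp measurable_snd).sub
      (((hratio s hs).comp measurable_fst).mul (measurable_uncurry_max hXcont hs hX))
  have hξmeas : ∀ (m : MeasurableSpace Ω) (s : ℝ), 0 ≤ s → Measurable[m] τ →
      (∀ r, s ≤ r → Measurable[m] (X r)) → Measurable[m] (ξ s) := by
    intro m s hs hτ hX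
    rw [show ξ s = fun ω => ξr (τ ω) s ω from funext fun ω => hξ s ω]
    exact (hbridge m s hs hX).comp (hτ.prodMk measurable_id)
  have hξzero : ∀ s ω, 0 < s → τ ω ≤ s → ξ s ω = 0 := by
    intro s ω hs hτs
    rw [hξ, hξr, max_eq_right hτs, div_self (hRpos s hs).ne']
    ring
  have hsection : ∀ r, t n < r → P {ω | ξr r (t n) ω = 0} = 0 := by
    intro r hr
    have hr0 : 0 < r := hT.trans hr
    set a := R (t n) r / R r r with ha
    have hbr : ∀ ω, ξr r (t n) ω = X (t n) ω - a * X r ω := fun ω => by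
      rw [hξr, max_eq_left hr.le]
    obtain ⟨v, hv⟩ := hGauss 2 ![t n, r] (by simp [Fin.forall_fin_two, hT.le, hr0.le]) ![1, -a]
    simp only [hbr]
    refine measure_sub_mul_eq_zero (hXmeas _) (hXmeas _) (v := v) ?_ ?_
    · rw [← hv]
      simp [Fin.sum_univ_two, sub_eq_add_neg]
    · simpa only [hR] using hRnd (t n) r hT hr0 hr.ne
  have hnull : ∀ᵐ ω ∂P, t n < τ ω → ξ (t n) ω ≠ 0 := by
    have hS : ∀ m : MeasurableSpace Ω, (∀ s, 0 ≤ s → Measurable[m] (X s)) →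
        MeasurableSet {p : ℝ × Ω | t n < p.1 ∧ ξr p.1 (t n) p.2 = 0} := fun m hX =>
      (measurable_fst measurableSet_Ioi).inter
        (hbridge m (t n) hT.le (fun r hr => hX r (hT.le.trans hr)) (measurableSet_singleton 0))
    have hindτ : @IndepFun Ω ℝ Ω _ _ (sigmaAfter X 0) τ id P := by
      refine (@IndepFun_iff_Indep _ _ _ _ _ (sigmaAfter X 0) _ _ _).2 ?_
      rw [MeasurableSpace.comap_id]
      exact hindep
    have := @IndepFun.measure_preimage_prodMk_eq_zero Ω ℝ Ω _ _ (sigmaAfter X 0) P _ τ id hτmeas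
      (measurable_id'' hmX) hindτ _
      (hS _ fun _ => measurable_sigmaAfter X) ?_
    · rw [ae_iff]
      convert this using 3 with ω
      simp [hξ]
    · intro r
      by_cases hr : t n < r
      · simpa [hr] using hsection r hr
      · simp [hr]
  have hV : Measurable fun ω (k : ι) => ξ (t k) ω := measurable_pi_iff.2 fun k =>
    hξmeas _ _ (hι k).1.le hτmeas fun r _ => hXmeas r
  have hafter : ∀ s, t n ≤ s →
      Measurable[sigmaAfter X (t n) ⊔ MeasurableSpace.comap τ inferInstance] (ξ s) := fun s hs =>
    hξmeas _ s (hT.le.trans hs) (Measurable.of_comap_le le_sup_right) fun r hr =>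
      (measurable_sigmaAfter X (hs.trans hr)).mono le_sup_left le_rfl
  have hcomap : (⨆ k ∈ Finset.Icc 1 n, MeasurableSpace.comap (ξ (t k)) inferInstance) =
      MeasurableSpace.comap (fun ω (k : ι) => ξ (t k) ω) inferInstance := by
    rw [iSup_subtype']
    change _ = MeasurableSpace.comap _ (⨆ k : ι, _)
    rw [MeasurableSpace.comap_iSup]
    simp only [MeasurableSpace.comap_comp]
    rfl
  rw [hcomap]
  refine condExp_comap_eq_condExp_comap_eval (hle) hV hZ i₀ c (hafter _ le_rfl)
    (hafter u htnu.le) hind (ae_of_all _ fun ω hω => ?_) ?_ hgmeas hgbdd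
  · have hτ : t n < τ ω := by
      by_contra! h
      exact hω (hξzero _ _ hT h)
    have hbefore : ∀ s, 0 < s → s ≤ t n → ξ s ω = X s ω - ρ s / ρ (τ ω) * X (τ ω) ω := by
      intro s hs hsn
      have hle : s ≤ τ ω := hsn.trans hτ.le
      rw [hξ, hξr, max_eq_left hle, hfact _ _ hs.le (hτpos ω).le,
        hfact _ _ (hτpos ω).le (hτpos ω).le, min_eq_left hle, max_eq_right hle, min_self, max_self,
        mul_div_mul_right _ _ (hqpos _ (hτpos ω)).ne']
    ext k
    have h0 := (hρpos _ hT).ne'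
    have h1 := (hρpos _ (hτpos ω)).ne'
    simp only [Pi.add_apply, Pi.smul_apply, smul_eq_mul, i₀, Z, c]
    rw [hbefore _ (hι k).1 (hι k).2, hbefore _ hT le_rfl]
    field_simp
    ring
  · filter_upwards [hnull] with ω hω hzero
    exact hξzero u ω (hT.trans htnu) ((not_lt.1 fun h => hω h hzero).trans htnu.le)
end
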